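/- arXiv:1702.00466 — 2 statements merged into one kernel-verified Lean document; each statement's English description precedes it below -/
import Mathlib

section
/- Let ν denote the restriction of the minimizer μ_a to ℝ² ∖ Γ. Then the topological support of ν is at positive distance from Γ: dist(Γ, supp ν) > 0. Equivalently, there exists ε > 0 such that μ_a({x ∈ ℝ² ∖ Γ : dist(x, Γ) < ε}) = 0. -/
open MeasureTheory Real
open scoped ENNReal

abbrev Plane : Type := EuclideanSpace ℝ (Fin 2)

noncomputable def logKernel (x y : Plane) : ℝ := Real.log (1 / dist x y)

/- For a probability measure `μ`, `wEnergy μ` equals `I[μ] + 1` where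
`I[μ] = ∫∫ log(1/|x-y|) dμdμ + ∫ |x|² dμ ∈ (-∞, +∞]`
(the kernel takes the value `+∞` on the diagonal). -/
open Classical in
noncomputable def wKernel (x y : Plane) : ℝ≥0∞ :=
  if x = y then ⊤ else ENNReal.ofReal (logKernel x y + (‖x‖ ^ 2 + ‖y‖ ^ 2) / 2 + 1)

noncomputable def wEnergy (μ : Measure Plane) : ℝ≥0∞ :=
  ∫⁻ p : Plane × Plane, wKernel p.1 p.2 ∂(μ.prod μ)

def Ma (Γ : Set Plane) (a : ℝ) : Set (Measure Plane) :=
  {μ | IsProbabilityMeasure μ ∧ ENNReal.ofReal a ≤ μ Γ}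

def IsMinimizer (Γ : Set Plane) (a : ℝ) (μa : Measure Plane) : Prop :=
  μa ∈ Ma Γ a ∧ wEnergy μa < ⊤ ∧ ∀ μ ∈ Ma Γ a, wEnergy μa ≤ wEnergy μ

structure RegularCurve (γ : ℝ → Plane) (Γ : Set Plane) : Prop where
  injective : Function.Injective γ
  image : Γ = Set.range γ
  closed : IsClosed Γ
  contDiff : ContDiff ℝ 1 γ
  unitSpeed : ∀ t, ‖deriv γ t‖ = 1
  holder : ∃ α : ℝ, α ∈ Set.Ioc (0:ℝ) 1 ∧ ∃ M : ℝ, 0 ≤ M ∧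
    ∀ s t : ℝ, ‖deriv γ t - deriv γ s‖ ≤ M * |t - s| ^ α



/-- The regularized kernel off the diagonal, as a real number. -/
noncomputable def realKernel (x y : Plane) : ℝ :=
  -log (dist x y) + (‖x‖ ^ 2 + ‖y‖ ^ 2) / 2 + 1

lemma wKernel_self (x : Plane) : wKernel x x = ⊤ := by simp [wKernel]

lemma wKernel_of_ne {x y : Plane} (h : x ≠ y) :
    wKernel x y = ENNReal.ofReal (realKernel x y) := by
  simp [wKernel, h, logKernel, realKernel]

lemma wKernel_comm (x y : Plane) : wKernel x y = wKernel y x := by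
  rcases eq_or_ne x y with rfl | h
  · rfl
  · rw [wKernel_of_ne h, wKernel_of_ne h.symm, realKernel, realKernel, dist_comm x y,
      add_comm (‖x‖ ^ 2)]

lemma measurable_wKernel : Measurable fun p : Plane × Plane => wKernel p.1 p.2 := by
  unfold wKernel logKernel
  refine Measurable.ite ?_ measurable_const ?_
  · exact (isClosed_eq continuous_fst continuous_snd).measurableSet
  · fun_prop

lemma dist_sq_le (x y : Plane) : dist x y ^ 2 ≤ 2 * (‖x‖ ^ 2 + ‖y‖ ^ 2) := by
  have h : dist x y ≤ ‖x‖ + ‖y‖ := by rw [dist_eq_norm]; exact norm_sub_le x y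
  nlinarith [sq_nonneg (‖x‖ - ‖y‖), dist_nonneg (x := x) (y := y), norm_nonneg x, norm_nonneg y]

lemma norm_sq_div_four_le_realKernel {x y : Plane} (h : x ≠ y) :
    ‖x‖ ^ 2 / 4 ≤ realKernel x y := by
  have hd : 0 < dist x y := dist_pos.2 h
  have h1 : log (dist x y / 2) ≤ dist x y ^ 2 / 8 := by
    have := log_le_sub_one_of_pos (show 0 < (dist x y / 2) ^ 2 by positivity)
    rw [log_pow] at this
    push_cast at this
    nlinarith
  rw [log_div hd.ne' two_ne_zero] at h1
  have := log_two_lt_d9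
  have := dist_sq_le x y
  unfold realKernel
  nlinarith [sq_nonneg ‖y‖]

lemma realKernel_nonneg {x y : Plane} (h : x ≠ y) : 0 ≤ realKernel x y :=
  (by positivity : 0 ≤ ‖x‖ ^ 2 / 4).trans (norm_sq_div_four_le_realKernel h)

lemma norm_sq_div_four_le_wKernel (x y : Plane) :
    ENNReal.ofReal (‖x‖ ^ 2 / 4) ≤ wKernel x y := by
  rcases eq_or_ne x y with rfl | h
  · simp [wKernel_self]
  · rw [wKernel_of_ne h]
    exact ENNReal.ofReal_le_ofReal (norm_sq_div_four_le_realKernel h)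

lemma wKernel_le_of_le_dist {x y : Plane} {c : ℝ} (hc : 0 < c) (h : c ≤ dist x y) :
    wKernel x y ≤ ENNReal.ofReal (-log c + (‖x‖ ^ 2 + ‖y‖ ^ 2) / 2 + 1) := by
  rw [wKernel_of_ne (dist_pos.1 (hc.trans_le h)), realKernel]
  have := log_le_log hc h
  gcongr

lemma continuous_wKernel_left (y : Plane) : Continuous fun x => wKernel x y := by
  rw [continuous_iff_continuousAt]
  intro x
  rcases eq_or_ne x y with rfl | h
  · rw [ContinuousAt, wKernel_self, ENNReal.tendsto_nhds_top_iff_nnreal]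
    intro M
    have hr : 0 < Real.exp (-M) := Real.exp_pos _
    filter_upwards [Metric.ball_mem_nhds x hr] with z hz
    rcases eq_or_ne z x with rfl | hne
    · simp [wKernel_self]
    · rw [wKernel_of_ne hne, ENNReal.lt_ofReal_iff_toReal_lt ENNReal.coe_ne_top, ENNReal.coe_toReal,
        realKernel]
      have := log_lt_log (dist_pos.2 hne) (Metric.mem_ball.1 hz)
      rw [Real.log_exp] at this
      have : 0 ≤ (‖z‖ ^ 2 + ‖x‖ ^ 2) / 2 := by positivity
      linarith
  · have hev : (fun x => wKernel x y) =ᶠ[nhds x] fun x => ENNReal.ofReal (realKernel x y) := by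
      filter_upwards [isOpen_ne.mem_nhds h] with z hz using wKernel_of_ne hz
    refine ContinuousAt.congr ?_ hev.symm
    unfold realKernel
    refine ENNReal.continuous_ofReal.continuousAt.comp ?_
    have := (dist_pos.2 h).ne'
    fun_prop (disch := assumption)

/-- The potential of a measure with respect to the kernel `wKernel`. -/
noncomputable def potential (μ : Measure Plane) (x : Plane) : ℝ≥0∞ :=
  ∫⁻ y, wKernel x y ∂μ

lemma measurable_potential (μ : Measure Plane) [SFinite μ] : Measurable (potential μ) :=
  measurable_wKernel.lintegral_prod_right'

lemma wEnergy_eq_lintegral_potential (μ : Measure Plane) [SFinite μ] :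
    wEnergy μ = ∫⁻ x, potential μ x ∂μ :=
  lintegral_prod _ measurable_wKernel.aemeasurable

lemma lintegral_potential_comm (μ ν : Measure Plane) [SFinite μ] [SFinite ν] :
    ∫⁻ x, potential μ x ∂ν = ∫⁻ x, potential ν x ∂μ := by
  unfold potential
  rw [lintegral_lintegral_swap measurable_wKernel.aemeasurable]
  simp_rw [wKernel_comm]

lemma potential_add (μ ν : Measure Plane) (x : Plane) :
    potential (μ + ν) x = potential μ x + potential ν x := lintegral_add_measure _ _ _

lemma potential_smul (c : ℝ≥0∞) (μ : Measure Plane) (x : Plane) :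
    potential (c • μ) x = c * potential μ x := lintegral_smul_measure _ _

lemma wEnergy_add (μ ν : Measure Plane) [SFinite μ] [SFinite ν] :
    wEnergy (μ + ν) = wEnergy μ + 2 * ∫⁻ x, potential μ x ∂ν + wEnergy ν := by
  simp_rw [wEnergy_eq_lintegral_potential, potential_add]
  rw [lintegral_add_measure, lintegral_add_left (measurable_potential μ),
    lintegral_add_left (measurable_potential μ), lintegral_potential_comm ν μ]
  ring

lemma wEnergy_smul (c : ℝ≥0∞) (μ : Measure Plane) [SFinite μ] :
    wEnergy (c • μ) = c * c * wEnergy μ := by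
  simp_rw [wEnergy_eq_lintegral_potential, potential_smul]
  rw [lintegral_smul_measure, lintegral_const_mul _ (measurable_potential μ), smul_eq_mul, mul_assoc]

lemma wEnergy_mono {μ ν : Measure Plane} [SFinite μ] [SFinite ν] (h : μ ≤ ν) :
    wEnergy μ ≤ wEnergy ν := by
  simp_rw [wEnergy_eq_lintegral_potential]
  exact (lintegral_mono fun x => lintegral_mono' h le_rfl).trans (lintegral_mono' h le_rfl)

lemma isClosed_potential_le (μ : Measure Plane) [SFinite μ] (c : ℝ≥0∞) :
    IsClosed {x | potential μ x ≤ c} := by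
  refine IsSeqClosed.isClosed fun u x hu hx => ?_
  calc potential μ x = ∫⁻ y, Filter.liminf (fun n => wKernel (u n) y) Filter.atTop ∂μ := by
        refine lintegral_congr fun y => ?_
        exact (((continuous_wKernel_left y).tendsto x).comp hx).liminf_eq.symm
    _ ≤ Filter.liminf (fun n => potential μ (u n)) Filter.atTop :=
        lintegral_liminf_le fun n => measurable_wKernel.comp measurable_prodMk_left
    _ ≤ c := by
        refine Filter.liminf_le_of_le (by isBoundedDefault) fun b hb => ?_
        obtain ⟨n, hn⟩ := hb.exists
        exact hn.trans (hu n)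

lemma norm_sq_div_four_le_potential (μ : Measure Plane) [IsProbabilityMeasure μ] (x : Plane) :
    ENNReal.ofReal (‖x‖ ^ 2 / 4) ≤ potential μ x := by
  calc _ = ∫⁻ _, ENNReal.ofReal (‖x‖ ^ 2 / 4) ∂μ := by simp
    _ ≤ _ := lintegral_mono fun y => norm_sq_div_four_le_wKernel x y

/-! ### First variation -/

lemma IsMinimizer.lintegral_potential_le {Γ : Set Plane} {a : ℝ} {μ μ' : Measure Plane}
    (hmin : IsMinimizer Γ a μ) (hμ' : μ' ∈ Ma Γ a) (hfin : wEnergy μ' < ⊤) :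
    ∫⁻ x, potential μ x ∂μ ≤ ∫⁻ x, potential μ x ∂μ' := by
  obtain ⟨⟨hp, hΓ⟩, hE, hle⟩ := hmin
  have hp' := hμ'.1
  by_contra! hlt
  rw [← wEnergy_eq_lintegral_potential] at hlt
  have key : ∀ t : ℝ, 0 ≤ t → t ≤ 1 → (wEnergy μ).toReal ≤
      (1 - t) * (1 - t) * (wEnergy μ).toReal +
      2 * (t * ((1 - t) * (∫⁻ x, potential μ x ∂μ').toReal)) + t * t * (wEnergy μ').toReal := by
    intro t h0 h1
    have hs : ENNReal.ofReal (1 - t) + ENNReal.ofReal t = 1 := by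
      rw [← ENNReal.ofReal_add (by linarith) h0]; simp
    have hmem : ENNReal.ofReal (1 - t) • μ + ENNReal.ofReal t • μ' ∈ Ma Γ a := by
      refine ⟨⟨by simp [hs]⟩, ?_⟩
      simp only [Measure.coe_add, Measure.coe_smul, Pi.add_apply, Pi.smul_apply, smul_eq_mul]
      calc ENNReal.ofReal a = ENNReal.ofReal (1 - t) * ENNReal.ofReal a
            + ENNReal.ofReal t * ENNReal.ofReal a := by rw [← add_mul, hs, one_mul]
        _ ≤ _ := add_le_add (mul_le_mul_right hΓ _) (mul_le_mul_right hμ'.2 _)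
    have h := hle _ hmem
    rw [wEnergy_add, wEnergy_smul, wEnergy_smul, lintegral_smul_measure] at h
    simp_rw [potential_smul] at h
    rw [lintegral_const_mul _ (measurable_potential μ), smul_eq_mul] at h
    have hf1 := hlt.ne_top
    have h2 := ENNReal.toReal_mono (by finiteness) h
    rw [ENNReal.toReal_add (by finiteness) (by finiteness),
      ENNReal.toReal_add (by finiteness) (by finiteness)] at h2
    simpa [ENNReal.toReal_mul, ENNReal.toReal_ofReal h0, ENNReal.toReal_ofReal (sub_nonneg.2 h1)]
      using h2
  have hlt' := (ENNReal.toReal_lt_toReal hlt.ne_top hE.ne).2 hlt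
  set e := (wEnergy μ).toReal
  set e' := (∫⁻ x, potential μ x ∂μ').toReal
  set e'' := (wEnergy μ').toReal
  set X := e - 2 * e' + e'' with hX
  have hδ : 0 < e - e' := by linarith
  have hpos : 0 < e - e' + |X| := by positivity
  have ht := key ((e - e') / (e - e' + |X|)) (by positivity)
    (by rw [div_le_one hpos]; linarith [abs_nonneg X])
  set t := (e - e') / (e - e' + |X|) with htdef
  have htpos : 0 < t := by positivity
  have htX : t * |X| ≤ e - e' := by
    rw [htdef, div_mul_eq_mul_div, div_le_iff₀ hpos]
    nlinarith [abs_nonneg X]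
  have h3 : 0 ≤ t * (t * X - 2 * (e - e')) := by rw [hX]; nlinarith
  have h4 := nonneg_of_mul_nonneg_right h3 htpos
  nlinarith [le_abs_self X]

lemma IsMinimizer.lintegral_potential_le_of_replace {Γ : Set Plane} {a : ℝ}
    {μ ρ τ σ : Measure Plane} [SFinite ρ] [SFinite σ]
    (hmin : IsMinimizer Γ a μ) (hμ : μ = ρ + τ) (huniv : σ Set.univ = τ Set.univ)
    (hΓ : τ Γ ≤ σ Γ) (hσ : wEnergy σ < ⊤) :
    ∫⁻ x, potential μ x ∂τ ≤ ∫⁻ x, potential μ x ∂σ := by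
  have hp := hmin.1.1
  have hmem : ρ + σ ∈ Ma Γ a := by
    refine ⟨⟨?_⟩, hmin.1.2.trans ?_⟩
    · rw [Measure.add_apply, huniv, ← Measure.add_apply, ← hμ, measure_univ]
    · rw [hμ, Measure.add_apply, Measure.add_apply]
      gcongr
  rcases eq_or_ne (∫⁻ x, potential μ x ∂σ) ⊤ with h | h
  · simp [h]
  have hρμ : ρ ≤ μ := hμ ▸ Measure.le_add_right le_rfl
  have h1 : wEnergy ρ ≠ ⊤ := ((wEnergy_mono hρμ).trans_lt hmin.2.1).ne
  have h2 : ∫⁻ x, potential ρ x ∂σ ≠ ⊤ :=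
    ((lintegral_mono fun x => lintegral_mono' hρμ le_rfl).trans_lt h.lt_top).ne
  have h3 := hmin.lintegral_potential_le hmem (by rw [wEnergy_add]; finiteness)
  have h4 : ∫⁻ x, potential μ x ∂ρ ≠ ⊤ := by
    refine ((lintegral_mono' hρμ le_rfl).trans_lt ?_).ne
    rw [← wEnergy_eq_lintegral_potential]; exact hmin.2.1
  rw [lintegral_add_measure] at h3
  have h5 : ∫⁻ x, potential μ x ∂μ = ∫⁻ x, potential μ x ∂ρ + ∫⁻ x, potential μ x ∂τ := by
    conv_lhs => rw [hμ]
    rw [lintegral_add_measure, ← hμ]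
  rw [h5] at h3
  exact (ENNReal.add_le_add_iff_left h4).1 h3

/-! ### Circular means -/

/-- The isometric identification of `ℂ` with the plane. -/
noncomputable def complexToPlane : ℂ ≃ₗᵢ[ℝ] Plane := Complex.orthonormalBasisOneI.repr

/-- The uniform probability measure on the angles `(0, 2π]`. -/
noncomputable def angleMeasure : Measure ℝ :=
  ENNReal.ofReal (2 * π)⁻¹ • volume.restrict (Set.Ioc 0 (2 * π))

instance : IsProbabilityMeasure angleMeasure := by
  refine ⟨?_⟩
  have : (0:ℝ) < 2 * π := by positivity
  simp only [angleMeasure, Measure.coe_smul, Pi.smul_apply, Measure.restrict_apply_univ,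
    Real.volume_Ioc, sub_zero, smul_eq_mul]
  rw [← ENNReal.ofReal_mul (by positivity), inv_mul_cancel₀ this.ne', ENNReal.ofReal_one]

lemma integral_angleMeasure (f : ℂ → ℝ) (c : ℂ) (r : ℝ) :
    ∫ θ, f (circleMap c r θ) ∂angleMeasure = circleAverage f c r := by
  rw [angleMeasure, integral_smul_measure, circleAverage,
    intervalIntegral.integral_of_le (by positivity), ENNReal.toReal_ofReal (by positivity)]

lemma integrable_angleMeasure {f : ℂ → ℝ} {c : ℂ} {r : ℝ} (h : CircleIntegrable f c r) :
    Integrable (fun θ => f (circleMap c r θ)) angleMeasure := by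
  refine Integrable.smul_measure ?_ ENNReal.ofReal_ne_top
  exact (intervalIntegrable_iff_integrableOn_Ioc_of_le (by positivity)).1 h

lemma circleAverage_norm_sq (z : ℂ) (r : ℝ) :
    circleAverage (fun ζ => ‖ζ‖ ^ 2) z r = ‖z‖ ^ 2 + r ^ 2 := by
  have h : ∀ θ, ‖circleMap z r θ‖ ^ 2 =
      (‖z‖ ^ 2 + r ^ 2) + (2 * r * z.re * cos θ + 2 * r * z.im * sin θ) := by
    intro θ
    rw [← Complex.normSq_eq_norm_sq, ← Complex.normSq_eq_norm_sq, Complex.normSq_apply,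
      Complex.normSq_apply]
    simp only [circleMap, Complex.add_re, Complex.mul_re, Complex.ofReal_re, Complex.exp_ofReal_mul_I_re,
      Complex.ofReal_im, Complex.exp_ofReal_mul_I_im, Complex.add_im, Complex.mul_im]
    nlinarith [sin_sq_add_cos_sq θ]
  have hpi : (2 * π) ≠ 0 := by positivity
  rw [circleAverage]
  simp_rw [h]
  have h0 : ∫ θ in 0..2 * π, (2 * r * z.re * cos θ + 2 * r * z.im * sin θ) = 0 := by
    rw [intervalIntegral.integral_add (by apply Continuous.intervalIntegrable; fun_prop)
      (by apply Continuous.intervalIntegrable; fun_prop)]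
    simp [intervalIntegral.integral_const_mul]
  rw [intervalIntegral.integral_add (by simp) (by apply Continuous.intervalIntegrable; fun_prop),
    h0, intervalIntegral.integral_const, smul_eq_mul, smul_eq_mul, sub_zero, add_zero,
    inv_mul_cancel_left₀ hpi]

lemma realKernel_complexToPlane (z w : ℂ) :
    realKernel (complexToPlane z) (complexToPlane w) =
      -log ‖z - w‖ + (‖z‖ ^ 2 / 2 + (‖w‖ ^ 2 / 2 + 1)) := by
  rw [realKernel, LinearIsometryEquiv.dist_map, LinearIsometryEquiv.norm_map,
    LinearIsometryEquiv.norm_map, dist_eq_norm]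
  ring

lemma circleIntegrable_realKernel (z w : ℂ) (r : ℝ) : CircleIntegrable
    (fun ζ => realKernel (complexToPlane ζ) (complexToPlane w)) z r := by
  simp_rw [realKernel_complexToPlane]
  refine (circleIntegrable_log_norm_sub_const r).neg.add ?_
  refine ContinuousOn.circleIntegrable' ?_
  fun_prop

lemma circleAverage_realKernel (z w : ℂ) {r : ℝ} (hr : r ≠ 0) :
    circleAverage (fun ζ => realKernel (complexToPlane ζ) (complexToPlane w)) z r =
      -(log r + log⁺ (r⁻¹ * ‖z - w‖)) + ((‖z‖ ^ 2 + r ^ 2) / 2 + (‖w‖ ^ 2 / 2 + 1)) := by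
  have h2 : CircleIntegrable (fun ζ : ℂ => ‖ζ‖ ^ 2 / 2) z r :=
    ContinuousOn.circleIntegrable' (by fun_prop)
  have h3 : CircleIntegrable (fun _ : ℂ => ‖w‖ ^ 2 / 2 + 1) z r :=
    ContinuousOn.circleIntegrable' (by fun_prop)
  have h1 : CircleIntegrable (fun ζ => -log ‖ζ - w‖) z r :=
    (circleIntegrable_log_norm_sub_const r).neg
  have h23 : CircleIntegrable (fun ζ : ℂ => ‖ζ‖ ^ 2 / 2 + (‖w‖ ^ 2 / 2 + 1)) z r := h2.add h3
  simp_rw [realKernel_complexToPlane]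
  rw [circleAverage_fun_add h1 h23]
  congr 1
  · rw [← circleAverage_log_norm_sub_const_eq_log_radius_add_posLog hr]
    simp [circleAverage]
  · rw [circleAverage_fun_add h2 h3, circleAverage_const, ← circleAverage_norm_sq]
    congr 1
    simp_rw [div_eq_inv_mul]
    exact circleAverage_smul (a := (2:ℝ)⁻¹) (f := fun ζ : ℂ => ‖ζ‖ ^ 2)

/-- The point at angle `θ` on the circle of radius `r` around `x`. -/
noncomputable def circlePoint (r : ℝ) (p : Plane × ℝ) : Plane :=
  complexToPlane (circleMap (complexToPlane.symm p.1) r p.2)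

lemma measurable_circlePoint (r : ℝ) : Measurable (circlePoint r) := by
  unfold circlePoint circleMap
  apply Continuous.measurable
  fun_prop

lemma lintegral_wKernel_circlePoint_add_le (x y : Plane) {r : ℝ} (hr : 0 < r) :
    ∫⁻ θ, wKernel (circlePoint r (x, θ)) y ∂angleMeasure +
      (Metric.closedBall x (r / 2)).indicator (fun _ => ENNReal.ofReal (log 2)) y ≤
    wKernel x y + ENNReal.ofReal (r ^ 2 / 2) := by
  rcases eq_or_ne x y with rfl | hne
  · simp [wKernel_self]
  obtain ⟨z, rfl⟩ := complexToPlane.surjective x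
  obtain ⟨w, rfl⟩ := complexToPlane.surjective y
  simp only [circlePoint, LinearIsometryEquiv.symm_apply_apply]
  have hzw : z ≠ w := fun h => hne (h ▸ rfl)
  have hd : 0 < ‖z - w‖ := norm_pos_iff.2 (sub_ne_zero.2 hzw)
  have hae : ∀ᵐ θ ∂angleMeasure, circleMap z r θ ≠ w := by
    have hc : {θ | ¬ circleMap z r θ ≠ w}.Countable := by
      have := (Set.countable_singleton w).preimage_circleMap z hr.ne'
      simpa [Set.preimage] using this
    refine Measure.smul_absolutelyContinuous (ae_restrict_of_ae ?_)
    exact hc.measure_zero volume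
  have hae' : ∀ᵐ θ ∂angleMeasure, complexToPlane (circleMap z r θ) ≠ complexToPlane w := by
    filter_upwards [hae] with θ hθ h using hθ (complexToPlane.injective h)
  rw [lintegral_congr_ae (hae'.mono fun θ hθ => wKernel_of_ne hθ),
    ← ofReal_integral_eq_lintegral_ofReal
      (integrable_angleMeasure (circleIntegrable_realKernel z w r))
      (hae'.mono fun θ hθ => realKernel_nonneg hθ),
    integral_angleMeasure (fun ζ => realKernel (complexToPlane ζ) (complexToPlane w)),
    wKernel_of_ne hne, ← ENNReal.ofReal_add (realKernel_nonneg hne) (by positivity)]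
  have hnn : 0 ≤ circleAverage (fun ζ => realKernel (complexToPlane ζ) (complexToPlane w)) z r := by
    rw [← integral_angleMeasure (fun ζ => realKernel (complexToPlane ζ) (complexToPlane w))]
    exact integral_nonneg_of_ae (hae'.mono fun θ hθ => realKernel_nonneg hθ)
  have hlog : log ‖z - w‖ = log r + log (r⁻¹ * ‖z - w‖) := by
    rw [log_mul (by positivity) hd.ne', log_inv]; ring
  by_cases hmem : complexToPlane w ∈ Metric.closedBall (complexToPlane z) (r / 2)
  · rw [Set.indicator_of_mem hmem, ← ENNReal.ofReal_add hnn (by positivity)]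
    refine ENNReal.ofReal_le_ofReal ?_
    rw [circleAverage_realKernel _ _ hr.ne', realKernel_complexToPlane, hlog]
    rw [Metric.mem_closedBall, LinearIsometryEquiv.dist_map, dist_comm, dist_eq_norm] at hmem
    have h1 : log (r⁻¹ * ‖z - w‖) ≤ log 2⁻¹ := by
      refine log_le_log (by positivity) ?_
      rw [inv_mul_le_iff₀ hr]; linarith
    rw [log_inv] at h1
    have := posLog_nonneg (x := r⁻¹ * ‖z - w‖)
    linarith
  · rw [Set.indicator_of_notMem hmem, add_zero]
    refine ENNReal.ofReal_le_ofReal ?_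
    rw [circleAverage_realKernel _ _ hr.ne', realKernel_complexToPlane, hlog]
    have : log (r⁻¹ * ‖z - w‖) ≤ log⁺ (r⁻¹ * ‖z - w‖) := le_max_right _ _
    linarith

/-- The circular mean of a measure: every point mass is spread uniformly over the circle of
radius `r` around it. -/
noncomputable def circularMean (r : ℝ) (τ : Measure Plane) : Measure Plane :=
  (τ.prod angleMeasure).map (circlePoint r)

lemma lintegral_circularMean {r : ℝ} {τ : Measure Plane} [SFinite τ] {f : Plane → ℝ≥0∞}
    (hf : Measurable f) :
    ∫⁻ x, f x ∂(circularMean r τ) = ∫⁻ x, ∫⁻ θ, f (circlePoint r (x, θ)) ∂angleMeasure ∂τ := by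
  rw [circularMean, lintegral_map hf (measurable_circlePoint r)]
  exact lintegral_prod _ (hf.comp (measurable_circlePoint r)).aemeasurable

instance (r : ℝ) (τ : Measure Plane) [IsFiniteMeasure τ] : IsFiniteMeasure (circularMean r τ) := by
  unfold circularMean; infer_instance

lemma circularMean_univ (r : ℝ) (τ : Measure Plane) [SFinite τ] :
    circularMean r τ Set.univ = τ Set.univ := by
  rw [circularMean, Measure.map_apply (measurable_circlePoint r) .univ, Set.preimage_univ,
    Measure.prod_apply .univ]
  simp

lemma lintegral_potential_circlePoint_add_le (μ : Measure Plane) [IsFiniteMeasure μ] (x : Plane)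
    {r : ℝ} (hr : 0 < r) :
    ∫⁻ θ, potential μ (circlePoint r (x, θ)) ∂angleMeasure +
      ENNReal.ofReal (log 2) * μ (Metric.closedBall x (r / 2)) ≤
    potential μ x + ENNReal.ofReal (r ^ 2 / 2) * μ Set.univ := by
  have hm : Measurable fun p : ℝ × Plane => wKernel (circlePoint r (x, p.1)) p.2 := by
    have h1 : Measurable fun p : ℝ × Plane => (circlePoint r (x, p.1), p.2) :=
      ((measurable_circlePoint r).comp (measurable_const.prodMk measurable_fst)).prodMk
        measurable_snd
    exact measurable_wKernel.comp h1
  unfold potential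
  rw [lintegral_lintegral_swap hm.aemeasurable,
    ← lintegral_indicator_const Metric.isClosed_closedBall.measurableSet,
    ← lintegral_add_right _
      (measurable_const.indicator Metric.isClosed_closedBall.measurableSet),
    ← lintegral_const, ← lintegral_add_right _ measurable_const]
  exact lintegral_mono fun y => lintegral_wKernel_circlePoint_add_le x y hr

lemma lintegral_potential_circularMean_add_le (μ τ : Measure Plane) [IsFiniteMeasure μ]
    [IsFiniteMeasure τ] {r : ℝ} (hr : 0 < r) :
    ∫⁻ x, potential μ x ∂(circularMean r τ) +
      ENNReal.ofReal (log 2) * ∫⁻ x, μ (Metric.closedBall x (r / 2)) ∂τ ≤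
    ∫⁻ x, potential μ x ∂τ + ENNReal.ofReal (r ^ 2 / 2) * μ Set.univ * τ Set.univ := by
  rw [lintegral_circularMean (measurable_potential μ), ← lintegral_const_mul' _ _ (by simp),
    ← lintegral_const, ← lintegral_add_left (measurable_potential μ), ← lintegral_add_left]
  · exact lintegral_mono fun x => lintegral_potential_circlePoint_add_le μ x hr
  · exact ((measurable_potential μ).comp (measurable_circlePoint r)).lintegral_prod_right'

lemma wEnergy_circularMean_lt_top {τ : Measure Plane} [IsFiniteMeasure τ] (hτ : wEnergy τ < ⊤)
    {r : ℝ} (hr : 0 < r) : wEnergy (circularMean r τ) < ⊤ := by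
  have h (μ : Measure Plane) [IsFiniteMeasure μ] (h : ∫⁻ x, potential μ x ∂τ < ⊤) :
      ∫⁻ x, potential μ x ∂(circularMean r τ) < ⊤ :=
    (le_self_add.trans (lintegral_potential_circularMean_add_le μ τ hr)).trans_lt (by finiteness)
  rw [wEnergy_eq_lintegral_potential]
  refine h _ ?_
  rw [lintegral_potential_comm]
  exact h _ (wEnergy_eq_lintegral_potential τ ▸ hτ)

/-! ### Means along short arcs -/

lemma RegularCurve.dist_le {γ : ℝ → Plane} {Γ : Set Plane} (hΓ : RegularCurve γ Γ) (s t : ℝ) :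
    dist (γ s) (γ t) ≤ |s - t| := by
  have h := Convex.norm_image_sub_le_of_norm_deriv_le (𝕜 := ℝ) (f := γ) (C := 1) (s := Set.univ)
    (fun x _ => (hΓ.contDiff.differentiable (by simp)) x) (fun x _ => (hΓ.unitSpeed x).le)
    convex_univ (Set.mem_univ t) (Set.mem_univ s)
  rwa [one_mul, ← dist_eq_norm, Real.norm_eq_abs] at h

lemma RegularCurve.continuous {γ : ℝ → Plane} {Γ : Set Plane} (hΓ : RegularCurve γ Γ) :
    Continuous γ := hΓ.contDiff.continuous

lemma RegularCurve.exists_half_le_dist {γ : ℝ → Plane} {Γ : Set Plane} (hΓ : RegularCurve γ Γ)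
    (t₀ : ℝ) : ∃ r₀ : ℝ, 0 < r₀ ∧ r₀ ≤ 1 ∧ ∀ s t : ℝ, |s - t₀| ≤ r₀ → |t - t₀| ≤ r₀ →
      |s - t| / 2 ≤ dist (γ s) (γ t) := by
  have h := (hΓ.contDiff.contDiffAt (x := t₀)).hasStrictDerivAt (by simp)
  have h2 := h.hasStrictFDerivAt.isLittleO.def (c := 1 / 2) (by norm_num)
  obtain ⟨ε, hε, hball⟩ := Metric.eventually_nhds_iff.1 h2
  refine ⟨min (ε / 2) 1, by positivity, min_le_right _ _, fun s t hs ht => ?_⟩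
  have h3 := @hball (s, t) (by
    rw [Prod.dist_eq, Real.dist_eq, Real.dist_eq]
    have := min_le_left (ε / 2) 1
    exact max_lt (by linarith) (by linarith))
  simp only [Real.norm_eq_abs, ContinuousLinearMap.toSpanSingleton_apply] at h3
  have h4 : ‖(s - t) • deriv γ t₀‖ = |s - t| := by
    rw [norm_smul, hΓ.unitSpeed, mul_one, Real.norm_eq_abs]
  have h5 := norm_sub_norm_le ((s - t) • deriv γ t₀) (γ s - γ t)
  rw [norm_sub_rev ((s - t) • deriv γ t₀), h4] at h5
  rw [dist_eq_norm]
  linarith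

/-- The uniform probability measure on `[-1, 1]`. -/
noncomputable def unitMeasure : Measure ℝ := (2 : ℝ≥0∞)⁻¹ • volume.restrict (Set.Icc (-1) 1)

instance : IsProbabilityMeasure unitMeasure := by
  refine ⟨?_⟩
  simp only [unitMeasure, Measure.coe_smul, Pi.smul_apply, Measure.restrict_apply_univ,
    Real.volume_Icc, smul_eq_mul]
  norm_num
  exact ENNReal.inv_mul_cancel (by simp) (by simp)

lemma unitMeasure_absolutelyContinuous : unitMeasure ≪ volume :=
  Measure.smul_absolutelyContinuous.trans Measure.absolutelyContinuous_restrict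

lemma ae_unitMeasure_mem : ∀ᵐ u ∂unitMeasure, u ∈ Set.Icc (-1 : ℝ) 1 :=
  Measure.smul_absolutelyContinuous (ae_restrict_mem measurableSet_Icc)

/-- An upper bound for the logarithmic potentials of `unitMeasure` on `[-1, 1]`. -/
noncomputable def logBound : ℝ≥0∞ := ∫⁻ v in Set.Icc (-2 : ℝ) 2, ENNReal.ofReal (-log |v|)

lemma logBound_lt_top : logBound < ⊤ := by
  have h : IntegrableOn (fun v => -log v) (Set.Icc (-2 : ℝ) 2) := by
    rw [integrableOn_Icc_iff_integrableOn_Ioc]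
    exact ((intervalIntegrable_iff_integrableOn_Ioc_of_le (by norm_num)).1
      intervalIntegral.intervalIntegrable_log').neg
  unfold logBound
  simp_rw [log_abs]
  exact h.lintegral_lt_top

lemma lintegral_log_le_logBound {w : ℝ} (hw : w ∈ Set.Icc (-1 : ℝ) 1) :
    ∫⁻ u, ENNReal.ofReal (-log |u - w|) ∂unitMeasure ≤ logBound := by
  set f : ℝ → ℝ≥0∞ := (Set.Icc (-2 : ℝ) 2).indicator fun v => ENNReal.ofReal (-log |v|) with hf
  calc ∫⁻ u, ENNReal.ofReal (-log |u - w|) ∂unitMeasure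
      ≤ ∫⁻ u in Set.Icc (-1 : ℝ) 1, ENNReal.ofReal (-log |u - w|) := by
        rw [unitMeasure, lintegral_smul_measure, smul_eq_mul]
        exact mul_le_of_le_one_left (zero_le) (by simp)
    _ ≤ ∫⁻ u in Set.Icc (-1 : ℝ) 1, f (u - w) := by
        refine setLIntegral_mono' measurableSet_Icc fun u hu => ?_
        rw [hf, Set.indicator_of_mem]
        exact ⟨by linarith [hu.1, hw.2], by linarith [hu.2, hw.1]⟩
    _ ≤ ∫⁻ u, f (u - w) := setLIntegral_le_lintegral _ _
    _ = ∫⁻ u, f u := lintegral_sub_right_eq_self f w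
    _ = logBound := by rw [hf, lintegral_indicator measurableSet_Icc, logBound]

lemma lintegral_wKernel_arc_le {γ : ℝ → Plane} {Γ : Set Plane} (hΓ : RegularCurve γ Γ)
    {t₀ r₀ : ℝ} (h1 : r₀ ≤ 1) (hsep : ∀ s t : ℝ, |s - t₀| ≤ r₀ → |t - t₀| ≤ r₀ →
      |s - t| / 2 ≤ dist (γ s) (γ t)) {r : ℝ} (hr : 0 < r) (hr₀ : r ≤ r₀) (y : Plane) {ρ : ℝ}
    (hρ : 0 < ρ) (hρr : ρ ≤ max r (dist (γ t₀) y)) :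
    ∫⁻ u, wKernel (γ (t₀ + r * u)) y ∂unitMeasure ≤ logBound + ENNReal.ofReal
      (-log ρ + log 16 + ((‖γ t₀‖ + 1) ^ 2 + ‖y‖ ^ 2) / 2 + 1) := by
  have hcont := hΓ.continuous
  have hdist : ∀ u ∈ Set.Icc (-1 : ℝ) 1, dist (γ (t₀ + r * u)) (γ t₀) ≤ r := by
    intro u hu
    refine (hΓ.dist_le _ _).trans ?_
    rw [add_sub_cancel_left, abs_mul, abs_of_pos hr]
    exact mul_le_of_le_one_right hr.le (abs_le.2 hu)
  have hpar : ∀ u ∈ Set.Icc (-1 : ℝ) 1, |t₀ + r * u - t₀| ≤ r₀ := by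
    intro u hu
    rw [add_sub_cancel_left, abs_mul, abs_of_pos hr]
    exact (mul_le_of_le_one_right hr.le (abs_le.2 hu)).trans hr₀
  obtain ⟨w, hw, hmin⟩ := isCompact_Icc.exists_isMinOn (Set.nonempty_Icc.2 (by norm_num))
    (show ContinuousOn (fun u => dist (γ (t₀ + r * u)) y) (Set.Icc (-1 : ℝ) 1) by fun_prop)
  have hlow : ∀ u ∈ Set.Icc (-1 : ℝ) 1, ρ * |u - w| / 16 ≤ dist (γ (t₀ + r * u)) y := by
    intro u hu
    have hA : r * |u - w| / 4 ≤ dist (γ (t₀ + r * u)) y := by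
      have h2 := hsep _ _ (hpar u hu) (hpar w hw)
      rw [show t₀ + r * u - (t₀ + r * w) = r * (u - w) by ring, abs_mul, abs_of_pos hr] at h2
      have h3 := dist_triangle_right (γ (t₀ + r * u)) (γ (t₀ + r * w)) y
      have h4 : dist (γ (t₀ + r * w)) y ≤ dist (γ (t₀ + r * u)) y := hmin hu
      linarith
    have habs : |u - w| ≤ 2 := abs_le.2 ⟨by linarith [hu.1, hw.2], by linarith [hu.2, hw.1]⟩
    have h0 := abs_nonneg (u - w)
    by_cases hcase : ρ ≤ 4 * r
    · nlinarith
    · push Not at hcase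
      have hρd : ρ ≤ dist (γ t₀) y := by
        rcases le_max_iff.1 hρr with h | h
        · linarith
        · exact h
      have h2 := dist_triangle_left (γ t₀) y (γ (t₀ + r * u))
      have h3 := hdist u hu
      nlinarith
  have hne : ∀ᵐ u ∂unitMeasure, u ≠ w :=
    unitMeasure_absolutelyContinuous (by simp)
  calc ∫⁻ u, wKernel (γ (t₀ + r * u)) y ∂unitMeasure
      ≤ ∫⁻ u, (ENNReal.ofReal (-log |u - w|) + ENNReal.ofReal
        (-log ρ + log 16 + ((‖γ t₀‖ + 1) ^ 2 + ‖y‖ ^ 2) / 2 + 1)) ∂unitMeasure := by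
        refine lintegral_mono_ae ?_
        filter_upwards [ae_unitMeasure_mem, hne] with u hu hne
        have hpos : 0 < |u - w| := abs_pos.2 (sub_ne_zero.2 hne)
        refine (wKernel_le_of_le_dist (by positivity) (hlow u hu)).trans ?_
        refine le_trans (ENNReal.ofReal_le_ofReal ?_) ENNReal.ofReal_add_le
        rw [log_div (by positivity) (by norm_num), log_mul hρ.ne' hpos.ne']
        have hz : ‖γ (t₀ + r * u)‖ ≤ ‖γ t₀‖ + 1 := by
          have h2 := norm_sub_norm_le (γ (t₀ + r * u)) (γ t₀)
          rw [← dist_eq_norm] at h2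
          linarith [hdist u hu]
        have := pow_le_pow_left₀ (norm_nonneg _) hz 2
        linarith
    _ ≤ _ := by
        rw [lintegral_add_right _ measurable_const, lintegral_const, measure_univ, mul_one]
        gcongr
        exact lintegral_log_le_logBound hw

/-- The normalized image of the Lebesgue measure on `[t₀ - r, t₀ + r]` under `γ`. -/
noncomputable def arcMeasure (γ : ℝ → Plane) (t₀ r : ℝ) : Measure Plane :=
  unitMeasure.map fun u => γ (t₀ + r * u)

lemma lintegral_arcMeasure {γ : ℝ → Plane} (hγ : Continuous γ) (t₀ r : ℝ) {f : Plane → ℝ≥0∞}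
    (hf : Measurable f) :
    ∫⁻ x, f x ∂(arcMeasure γ t₀ r) = ∫⁻ u, f (γ (t₀ + r * u)) ∂unitMeasure :=
  lintegral_map hf (Continuous.measurable (by fun_prop))

lemma isProbabilityMeasure_arcMeasure {γ : ℝ → Plane} (hγ : Continuous γ) (t₀ r : ℝ) :
    IsProbabilityMeasure (arcMeasure γ t₀ r) :=
  Measure.isProbabilityMeasure_map (Continuous.aemeasurable (by fun_prop))

lemma RegularCurve.arcMeasure_eq_one {γ : ℝ → Plane} {Γ : Set Plane} (hΓ : RegularCurve γ Γ)
    (t₀ r : ℝ) : arcMeasure γ t₀ r Γ = 1 := by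
  have := hΓ.continuous
  rw [arcMeasure, Measure.map_apply (Continuous.measurable (by fun_prop))
    hΓ.closed.measurableSet, hΓ.image]
  simp [Set.preimage]

lemma lintegral_potential_arcMeasure {γ : ℝ → Plane} (hγ : Continuous γ) (t₀ r : ℝ)
    (μ : Measure Plane) [SFinite μ] :
    ∫⁻ x, potential μ x ∂(arcMeasure γ t₀ r) =
      ∫⁻ y, ∫⁻ u, wKernel (γ (t₀ + r * u)) y ∂unitMeasure ∂μ := by
  rw [lintegral_arcMeasure hγ t₀ r (measurable_potential μ)]
  unfold potential
  refine lintegral_lintegral_swap (Measurable.aemeasurable ?_)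
  have h1 : Measurable fun p : ℝ × Plane => (γ (t₀ + r * p.1), p.2) :=
    Continuous.measurable (by fun_prop)
  exact measurable_wKernel.comp h1

lemma wEnergy_arcMeasure_lt_top {γ : ℝ → Plane} {Γ : Set Plane} (hΓ : RegularCurve γ Γ)
    {t₀ r₀ : ℝ} (h1 : r₀ ≤ 1) (hsep : ∀ s t : ℝ, |s - t₀| ≤ r₀ → |t - t₀| ≤ r₀ →
      |s - t| / 2 ≤ dist (γ s) (γ t)) {r : ℝ} (hr : 0 < r) (hr₀ : r ≤ r₀) :
    wEnergy (arcMeasure γ t₀ r) < ⊤ := by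
  have hcont := hΓ.continuous
  have := isProbabilityMeasure_arcMeasure hcont t₀ r
  rw [wEnergy_eq_lintegral_potential, lintegral_potential_arcMeasure hcont,
    lintegral_arcMeasure hcont]
  · refine lt_of_le_of_lt (lintegral_mono_ae (g := fun _ => logBound + ENNReal.ofReal
      (-log r + log 16 + ((‖γ t₀‖ + 1) ^ 2 + (‖γ t₀‖ + 1) ^ 2) / 2 + 1)) ?_) ?_
    · filter_upwards [ae_unitMeasure_mem] with v hv
      refine (lintegral_wKernel_arc_le hΓ h1 hsep hr hr₀ _ hr (le_max_left _ _)).trans ?_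
      have hz : ‖γ (t₀ + r * v)‖ ≤ ‖γ t₀‖ + 1 := by
        have h2 := norm_sub_norm_le (γ (t₀ + r * v)) (γ t₀)
        rw [← dist_eq_norm] at h2
        have h3 := hΓ.dist_le (t₀ + r * v) t₀
        rw [add_sub_cancel_left, abs_mul, abs_of_pos hr] at h3
        have := mul_le_of_le_one_right hr.le (abs_le.2 hv)
        linarith
      gcongr
    · rw [lintegral_const, measure_univ, mul_one]
      have := logBound_lt_top
      finiteness
  · have h2 : Measurable fun p : Plane × ℝ => (γ (t₀ + r * p.2), p.1) :=
      Continuous.measurable (by fun_prop)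
    exact (measurable_wKernel.comp h2).lintegral_prod_right'

lemma limsup_lintegral_wKernel_arc_le {γ : ℝ → Plane} (hγ : Continuous γ) (t₀ : ℝ) (y : Plane)
    {r : ℕ → ℝ} (hr : Filter.Tendsto r Filter.atTop (nhds 0)) :
    Filter.limsup (fun n => ∫⁻ u, wKernel (γ (t₀ + r n * u)) y ∂unitMeasure) Filter.atTop ≤
      wKernel (γ t₀) y := by
  refine le_of_forall_gt_imp_ge_of_dense fun b hb => ?_
  refine Filter.limsup_le_of_le (by isBoundedDefault) ?_
  have h1 : ∀ᶠ t in nhds t₀, wKernel (γ t) y < b :=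
    ((continuous_wKernel_left y).comp hγ).continuousAt.eventually_lt continuousAt_const hb
  obtain ⟨ε, hε, hball⟩ := Metric.eventually_nhds_iff.1 h1
  filter_upwards [(Metric.tendsto_nhds.1 hr) ε hε] with n hn
  calc ∫⁻ u, wKernel (γ (t₀ + r n * u)) y ∂unitMeasure ≤ ∫⁻ _, b ∂unitMeasure := by
        refine lintegral_mono_ae ?_
        filter_upwards [ae_unitMeasure_mem] with u hu
        refine (hball ?_).le
        rw [Real.dist_eq, add_sub_cancel_left, abs_mul]
        rw [Real.dist_eq, sub_zero] at hn
        exact (mul_le_of_le_one_right (abs_nonneg _) (abs_le.2 hu)).trans_lt hn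
    _ = b := by simp

/-- The mean of a potential over short arcs does not exceed its value at the midpoint by much. -/
lemma limsup_lintegral_potential_arcMeasure_le {γ : ℝ → Plane} {Γ : Set Plane}
    (hΓ : RegularCurve γ Γ) (μ : Measure Plane) [IsFiniteMeasure μ]
    {t₀ r₀ : ℝ} (h1 : r₀ ≤ 1) (hsep : ∀ s t : ℝ, |s - t₀| ≤ r₀ → |t - t₀| ≤ r₀ →
      |s - t| / 2 ≤ dist (γ s) (γ t)) {r : ℕ → ℝ} (hr0 : Filter.Tendsto r Filter.atTop (nhds 0))
    (hr : ∀ n, 0 < r n) (hr₀ : ∀ n, r n ≤ r₀) :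
    Filter.limsup (fun n => ∫⁻ x, potential μ x ∂(arcMeasure γ t₀ (r n))) Filter.atTop ≤
      potential μ (γ t₀) := by
  have hcont := hΓ.continuous
  rcases eq_or_ne (potential μ (γ t₀)) ⊤ with htop | htop
  · simp [htop]
  set C : ℝ := log 16 + ‖γ t₀‖ + 1 / 2
  simp_rw [lintegral_potential_arcMeasure hcont]
  refine (limsup_lintegral_le (g := fun y => wKernel (γ t₀) y + (logBound + ENNReal.ofReal C))
    ?_ (fun n => Filter.Eventually.of_forall fun y => ?_) ?_).trans ?_
  · intro n
    have h2 : Measurable fun p : Plane × ℝ => (γ (t₀ + r n * p.2), p.1) :=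
      Continuous.measurable (by fun_prop)
    exact (measurable_wKernel.comp h2).lintegral_prod_right'
  · dsimp only
    rcases eq_or_ne (γ t₀) y with hy | hy
    · simp [hy, wKernel_self]
    · refine (lintegral_wKernel_arc_le hΓ h1 hsep (hr n) (hr₀ n) y (dist_pos.2 hy)
        (le_max_right _ _)).trans ?_
      rw [wKernel_of_ne hy, add_left_comm]
      gcongr
      refine le_trans (ENNReal.ofReal_le_ofReal ?_) ENNReal.ofReal_add_le
      rw [realKernel]
      apply le_of_eq
      ring
  · rw [lintegral_add_right _ measurable_const, lintegral_const]
    have := logBound_lt_top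
    have : ∫⁻ y, wKernel (γ t₀) y ∂μ ≠ ⊤ := htop
    finiteness
  · exact lintegral_mono fun y => limsup_lintegral_wKernel_arc_le hcont t₀ y hr0

/-! ### Concentration of measures on a rectifiable curve -/

lemma RegularCurve.sq_measure_le {γ : ℝ → Plane} {Γ : Set Plane} (hΓ : RegularCurve γ Γ)
    (τ : Measure Plane) {L : ℝ} (hL : 0 < L) {N : ℕ} (hN : 0 < N) :
    τ (γ '' Set.Ico (-L) L) ^ 2 ≤ N * ∫⁻ x, τ (Metric.closedBall x (2 * L / N)) ∂τ := by
  have hN' : (0 : ℝ) < N := by exact_mod_cast hN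
  set h : ℝ := 2 * L / N with hh
  have hpos : 0 < h := by positivity
  set B : ℕ → Set ℝ := fun i => {t | t ∈ Set.Ico (-L) L ∧ ⌊(t + L) / h⌋₊ = i} with hB
  have hBm : ∀ i, MeasurableSet (B i) := fun i => by
    refine measurableSet_Ico.inter ?_
    have : Measurable fun t : ℝ => ⌊(t + L) / h⌋₊ := Nat.measurable_floor.comp (by fun_prop)
    exact this (measurableSet_singleton i)
  have hAm : ∀ i, MeasurableSet (γ '' B i) := fun i =>
    (hBm i).image_of_continuousOn_injOn hΓ.continuous.continuousOn hΓ.injective.injOn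
  have hcover : γ '' Set.Ico (-L) L ⊆ ⋃ i ∈ Finset.range N, γ '' B i := by
    rintro _ ⟨t, ht, rfl⟩
    refine Set.mem_biUnion (x := ⌊(t + L) / h⌋₊) ?_ ⟨t, ⟨ht, rfl⟩, rfl⟩
    rw [Finset.mem_coe, Finset.mem_range, Nat.floor_lt' hN.ne', div_lt_iff₀ hpos, hh]
    field_simp
    linarith [ht.2]
  have hdisj : Set.PairwiseDisjoint (↑(Finset.range N)) fun i => γ '' B i := by
    intro i _ j _ hij
    refine (Set.disjoint_image_iff hΓ.injective).2 (Set.disjoint_left.2 fun t hi hj => hij ?_)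
    exact hi.2.symm.trans hj.2
  have hball : ∀ i, ∀ x ∈ γ '' B i, γ '' B i ⊆ Metric.closedBall x h := by
    rintro i _ ⟨t, ht, rfl⟩ _ ⟨s, hs, rfl⟩
    refine (hΓ.dist_le s t).trans ?_
    have hfl : ∀ t ∈ B i, i * h ≤ t + L ∧ t + L < (i + 1) * h := by
      intro t ht
      have h0 : 0 ≤ (t + L) / h := div_nonneg (by linarith [ht.1.1]) hpos.le
      rw [← le_div_iff₀ hpos, ← div_lt_iff₀ hpos, ← ht.2]
      exact ⟨Nat.floor_le h0, Nat.lt_floor_add_one _⟩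
    have h1 := hfl t ht
    have h2 := hfl s hs
    exact abs_le.2 ⟨by linarith, by linarith⟩
  have hCS := ENNReal.rpow_sum_le_const_mul_sum_rpow (Finset.range N) (fun i => τ (γ '' B i))
    (p := 2) (by norm_num)
  rw [Finset.card_range, show (2 : ℝ) - 1 = 1 by norm_num, ENNReal.rpow_one] at hCS
  simp only [ENNReal.rpow_two] at hCS
  calc τ (γ '' Set.Ico (-L) L) ^ 2 ≤ (∑ i ∈ Finset.range N, τ (γ '' B i)) ^ 2 := by
        gcongr
        exact (measure_mono hcover).trans (measure_biUnion_finset_le _ _)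
    _ ≤ N * ∑ i ∈ Finset.range N, τ (γ '' B i) ^ 2 := hCS
    _ ≤ N * ∑ i ∈ Finset.range N, ∫⁻ x in γ '' B i, τ (Metric.closedBall x h) ∂τ := by
        gcongr with i
        rw [sq, ← setLIntegral_const]
        exact setLIntegral_mono' (hAm i) fun x hx => measure_mono (hball i x hx)
    _ = N * ∫⁻ x in ⋃ i ∈ Finset.range N, γ '' B i, τ (Metric.closedBall x h) ∂τ := by
        rw [lintegral_biUnion_finset hdisj fun i _ => hAm i]
    _ ≤ _ := by
        gcongr
        exact Measure.restrict_le_self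

lemma RegularCurve.exists_measure_image_Ico_ne_zero {γ : ℝ → Plane} {Γ : Set Plane}
    (hΓ : RegularCurve γ Γ) {τ : Measure Plane} (hτ : τ Γ ≠ 0) :
    ∃ L : ℝ, 0 < L ∧ τ (γ '' Set.Ico (-L) L) ≠ 0 := by
  by_contra! hzero
  refine hτ (measure_mono_null ?_ (measure_iUnion_null fun n : ℕ =>
    hzero ((n : ℝ) + 1) (by positivity)))
  rw [hΓ.image]
  rintro _ ⟨t, rfl⟩
  obtain ⟨n, hn⟩ := exists_nat_gt |t|
  have := abs_lt.1 hn
  exact Set.mem_iUnion.2 ⟨n, t, ⟨by linarith, by linarith⟩, rfl⟩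

/-- Spreading a measure charging a regular curve over small circles strictly decreases the mean
of any potential whose measure dominates it. -/
lemma RegularCurve.exists_lintegral_potential_circularMean_lt {γ : ℝ → Plane} {Γ : Set Plane}
    (hΓ : RegularCurve γ Γ) {μ τ : Measure Plane} [IsProbabilityMeasure μ] (hle : τ ≤ μ)
    (hτ : τ Γ ≠ 0) (hfin : ∫⁻ x, potential μ x ∂τ ≠ ⊤) :
    ∃ r : ℝ, 0 < r ∧ ∫⁻ x, potential μ x ∂(circularMean r τ) < ∫⁻ x, potential μ x ∂τ := by
  have : IsFiniteMeasure τ := isFiniteMeasure_of_le μ hle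
  by_contra! hge
  obtain ⟨L, hL, hm⟩ := hΓ.exists_measure_image_Ico_ne_zero hτ
  set m := τ (γ '' Set.Ico (-L) L)
  have hgain : ∀ r : ℝ, 0 < r →
      ENNReal.ofReal (log 2) * ∫⁻ x, τ (Metric.closedBall x (r / 2)) ∂τ ≤
        ENNReal.ofReal (r ^ 2 / 2) := by
    intro r hr
    have h1 := lintegral_potential_circularMean_add_le μ τ hr
    have h2 := (add_le_add_left (hge r hr) _).trans h1
    rw [ENNReal.add_le_add_iff_left hfin, measure_univ, mul_one] at h2
    calc _ ≤ ENNReal.ofReal (log 2) * ∫⁻ x, μ (Metric.closedBall x (r / 2)) ∂τ := by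
          gcongr
      _ ≤ ENNReal.ofReal (r ^ 2 / 2) * τ Set.univ := h2
      _ ≤ ENNReal.ofReal (r ^ 2 / 2) * 1 := by
          gcongr
          exact (hle _).trans prob_le_one
      _ = _ := mul_one _
  have hm_pos : 0 < m.toReal := ENNReal.toReal_pos hm (measure_ne_top _ _)
  have hlog : 0 < log 2 := log_pos one_lt_two
  obtain ⟨N, hN⟩ := exists_nat_gt (8 * L ^ 2 / (log 2 * m.toReal ^ 2))
  have hN0 : (0 : ℝ) < N := lt_of_le_of_lt (by positivity) hN
  rw [div_lt_iff₀ (by positivity)] at hN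
  have h1 := hΓ.sq_measure_le τ hL (N := N) (by exact_mod_cast hN0)
  have h2 := hgain (4 * L / N) (by positivity)
  rw [show 4 * L / N / 2 = 2 * L / N by ring] at h2
  have h3 : ENNReal.ofReal (log 2) * m ^ 2 ≤ N * ENNReal.ofReal ((4 * L / N) ^ 2 / 2) :=
    calc _ ≤ ENNReal.ofReal (log 2) *
          (N * ∫⁻ x, τ (Metric.closedBall x (2 * L / N)) ∂τ) := by gcongr
      _ = N * (ENNReal.ofReal (log 2) * ∫⁻ x, τ (Metric.closedBall x (2 * L / N)) ∂τ) := by ring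
      _ ≤ _ := by gcongr
  have h4 := ENNReal.toReal_mono (by finiteness) h3
  rw [ENNReal.toReal_mul, ENNReal.toReal_mul, ENNReal.toReal_pow, ENNReal.toReal_ofReal hlog.le,
    ENNReal.toReal_ofReal (by positivity), ENNReal.toReal_natCast] at h4
  have h5 : (N : ℝ) * ((4 * L / N) ^ 2 / 2) * N = 8 * L ^ 2 := by
    field_simp
    ring
  nlinarith [mul_le_mul_of_nonneg_right h4 hN0.le]

/-! ### Variational inequalities -/

lemma IsMinimizer.lintegral_potential_restrict_lt_top {Γ : Set Plane} {a : ℝ} {μ : Measure Plane}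
    (hmin : IsMinimizer Γ a μ) (s : Set Plane) : ∫⁻ x, potential μ x ∂(μ.restrict s) < ⊤ := by
  have := hmin.1.1
  refine (lintegral_mono' Measure.restrict_le_self le_rfl).trans_lt ?_
  rw [← wEnergy_eq_lintegral_potential]
  exact hmin.2.1

lemma IsMinimizer.div_le_potential {γ : ℝ → Plane} {Γ : Set Plane} (hΓ : RegularCurve γ Γ)
    {a : ℝ} {μ : Measure Plane} (hmin : IsMinimizer Γ a μ) {x : Plane} (hx : x ∈ Γ) :
    (∫⁻ x, potential μ x ∂(μ.restrict Γ)) / μ Γ ≤ potential μ x := by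
  have hp := hmin.1.1
  rw [hΓ.image] at hx
  obtain ⟨t₀, rfl⟩ := hx
  obtain ⟨r₀, hr₀, h1, hsep⟩ := hΓ.exists_half_le_dist t₀
  set r : ℕ → ℝ := fun n => r₀ * (1 / (n + 1 : ℝ)) with hr
  have hrpos : ∀ n, 0 < r n := fun n => by positivity
  have hrle : ∀ n, r n ≤ r₀ := fun n => by
    refine mul_le_of_le_one_right hr₀.le ?_
    rw [div_le_one (by positivity)]
    linarith [Nat.cast_nonneg (α := ℝ) n]
  have hr0 : Filter.Tendsto r Filter.atTop (nhds 0) := by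
    simpa [hr] using tendsto_one_div_add_atTop_nhds_zero_nat.const_mul r₀
  refine le_trans ?_ (limsup_lintegral_potential_arcMeasure_le hΓ μ h1 hsep hr0 hrpos hrle)
  rw [← Filter.limsup_const (f := (Filter.atTop : Filter ℕ))
    ((∫⁻ x, potential μ x ∂(μ.restrict Γ)) / μ Γ)]
  refine Filter.limsup_le_limsup (Filter.Eventually.of_forall fun n => ?_)
  dsimp only
  have := isProbabilityMeasure_arcMeasure hΓ.continuous t₀ (r n)
  have hE := wEnergy_arcMeasure_lt_top hΓ h1 hsep (hrpos n) (hrle n)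
  have h := hmin.lintegral_potential_le_of_replace (ρ := μ.restrict Γᶜ) (τ := μ.restrict Γ)
    (σ := μ Γ • arcMeasure γ t₀ (r n))
    (by rw [add_comm, Measure.restrict_add_restrict_compl hΓ.closed.measurableSet])
    (by simp) (by simp [hΓ.arcMeasure_eq_one])
    (by rw [wEnergy_smul]; finiteness)
  rw [lintegral_smul_measure, smul_eq_mul] at h
  exact ENNReal.div_le_of_le_mul' h

lemma IsMinimizer.ae_potential_le_div {Γ : Set Plane} (hΓ : MeasurableSet Γ) {a : ℝ}
    {μ : Measure Plane} (hmin : IsMinimizer Γ a μ) (hpos : μ Γᶜ ≠ 0) :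
    ∀ᵐ x ∂(μ.restrict Γᶜ),
      potential μ x ≤ (∫⁻ x, potential μ x ∂(μ.restrict Γᶜ)) / μ Γᶜ := by
  have hp := hmin.1.1
  refine ae_le_of_forall_setLIntegral_le_of_sigmaFinite (measurable_potential μ)
    fun E hE _ => ?_
  rw [setLIntegral_const, Measure.restrict_restrict hE, Measure.restrict_apply hE]
  set A := E ∩ Γᶜ
  have hA : MeasurableSet A := hE.inter hΓ.compl
  have hfin : wEnergy (μ.restrict Γᶜ) < ⊤ :=
    (wEnergy_mono Measure.restrict_le_self).trans_lt hmin.2.1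
  have hc : μ A / μ Γᶜ ≠ ⊤ := ENNReal.div_ne_top (measure_ne_top _ _) hpos
  have h := hmin.lintegral_potential_le_of_replace (ρ := μ.restrict Aᶜ) (τ := μ.restrict A)
    (σ := (μ A / μ Γᶜ) • μ.restrict Γᶜ)
    (by rw [add_comm, Measure.restrict_add_restrict_compl hA])
    (by simp [ENNReal.div_mul_cancel hpos])
    (by
      rw [Measure.restrict_apply hΓ, show Γ ∩ A = ∅ by ext x; simp [A]; tauto]
      simp)
    (by rw [wEnergy_smul]; finiteness)
  rw [lintegral_smul_measure, smul_eq_mul] at h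
  refine h.trans_eq ?_
  simp only [div_eq_mul_inv]
  ring

lemma IsMinimizer.div_lt_div {γ : ℝ → Plane} {Γ : Set Plane} (hΓ : RegularCurve γ Γ)
    {a : ℝ} (ha : 0 < a) {μ : Measure Plane} (hmin : IsMinimizer Γ a μ) (hpos : μ Γᶜ ≠ 0) :
    (∫⁻ x, potential μ x ∂(μ.restrict Γᶜ)) / μ Γᶜ <
      (∫⁻ x, potential μ x ∂(μ.restrict Γ)) / μ Γ := by
  have hp := hmin.1.1
  have hm : μ Γ ≠ 0 := ((ENNReal.ofReal_pos.2 ha).trans_le hmin.1.2).ne'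
  obtain ⟨r, hr, hlt⟩ := hΓ.exists_lintegral_potential_circularMean_lt (τ := μ.restrict Γ)
    Measure.restrict_le_self (by simpa using hm)
    (hmin.lintegral_potential_restrict_lt_top Γ).ne
  have hfin : wEnergy (circularMean r (μ.restrict Γ)) < ⊤ := wEnergy_circularMean_lt_top
    ((wEnergy_mono Measure.restrict_le_self).trans_lt hmin.2.1) hr
  have hc : μ Γᶜ / μ Γ ≠ ⊤ := ENNReal.div_ne_top (measure_ne_top _ _) hm
  have hc0 : μ Γᶜ / μ Γ ≠ 0 := (ENNReal.div_pos hpos (measure_ne_top _ _)).ne'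
  have h := hmin.lintegral_potential_le_of_replace (ρ := μ.restrict Γ) (τ := μ.restrict Γᶜ)
    (σ := (μ Γᶜ / μ Γ) • circularMean r (μ.restrict Γ))
    (by rw [Measure.restrict_add_restrict_compl hΓ.closed.measurableSet])
    (by simp [circularMean_univ, ENNReal.div_mul_cancel hm])
    (by rw [Measure.restrict_apply hΓ.closed.measurableSet]; simp)
    (by rw [wEnergy_smul]; finiteness)
  rw [lintegral_smul_measure, smul_eq_mul] at h
  have h2 := h.trans_lt ((ENNReal.mul_lt_mul_iff_right hc0 hc).2 hlt)
  refine ENNReal.div_lt_of_lt_mul' (h2.trans_eq ?_)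
  simp only [div_eq_mul_inv]
  ring

/-- the restriction of `μ_a` to `ℝ² ∖ Γ` has support at positive
distance from `Γ`: there is `ε > 0` such that
`μ_a({x ∉ Γ : dist(x, Γ) < ε}) = 0`. -/
theorem statement15 (γ : ℝ → Plane) (Γ : Set Plane) (hΓ : RegularCurve γ Γ)
    (a : ℝ) (ha : a ∈ Set.Ioo (0:ℝ) 1)
    (μa : Measure Plane) (hmin : IsMinimizer Γ a μa) :
    ∃ ε : ℝ, 0 < ε ∧ μa {x : Plane | x ∉ Γ ∧ Metric.infDist x Γ < ε} = 0 := by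
  have hp := hmin.1.1
  rcases eq_or_ne (μa Γᶜ) 0 with hzero | hpos
  · exact ⟨1, one_pos, measure_mono_null (fun x hx => hx.1) hzero⟩
  set c := (∫⁻ x, potential μa x ∂(μa.restrict Γᶜ)) / μa Γᶜ with hc
  have hctop : c ≠ ⊤ :=
    ENNReal.div_ne_top (hmin.lintegral_potential_restrict_lt_top Γᶜ).ne hpos
  have hae := hmin.ae_potential_le_div hΓ.closed.measurableSet hpos
  rw [← hc] at hae
  have hopen : IsOpen {x | c < potential μa x} := by
    simpa [Set.compl_ofPred] using (isClosed_potential_le μa c).isOpen_compl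
  have hnull : μa {x | x ∉ Γ ∧ c < potential μa x} = 0 := by
    rw [ae_restrict_iff' hΓ.closed.measurableSet.compl, ae_iff] at hae
    refine measure_mono_null (fun x hx => ?_) hae
    simpa using hx
  have hsub : ∀ x ∈ Γ, c < potential μa x := fun x hx =>
    (hmin.div_lt_div hΓ ha.1 hpos).trans_le (hmin.div_le_potential hΓ hx)
  set R := 2 * c.toReal + 2 with hR
  have hc0 : 0 ≤ c.toReal := ENNReal.toReal_nonneg
  have hfar : ∀ x : Plane, R < ‖x‖ → c < potential μa x := by
    intro x hx
    refine lt_of_lt_of_le ?_ (norm_sq_div_four_le_potential μa x)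
    rw [ENNReal.lt_ofReal_iff_toReal_lt hctop]
    nlinarith
  obtain ⟨δ, hδ, hthick⟩ :=
    ((isCompact_closedBall (0 : Plane) (R + 1)).inter_right hΓ.closed).exists_thickening_subset_open
      hopen fun x hx => hsub x hx.2
  refine ⟨min δ 1, by positivity, measure_mono_null ?_ hnull⟩
  refine fun x (hx : x ∉ Γ ∧ Metric.infDist x Γ < min δ 1) => ⟨hx.1, ?_⟩
  have hne : Γ.Nonempty := hΓ.image ▸ Set.range_nonempty γ
  obtain ⟨y, hy, hxy⟩ := (Metric.infDist_lt_iff hne).1 hx.2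
  by_cases hyR : ‖y‖ ≤ R + 1
  · refine hthick (Metric.mem_thickening_iff.2 ⟨y, ⟨?_, hy⟩, hxy.trans_le (min_le_left _ _)⟩)
    simpa using hyR
  · refine hfar x ?_
    have h1 := norm_sub_norm_le y x
    rw [← dist_eq_norm, dist_comm] at h1
    have h2 := hxy.trans_le (min_le_right _ _)
    linarith
end

section
/- Let μ be a compactly supported Borel probability measure on ℝ² with finite logarithmic energy whose support is contained in the open ball B_{r₀} = {x ∈ ℝ² : |x| < r₀}. Then ∫ |x|² dμ(x) = −(2/π) ∫_{B_{r₀}} U^μ(x) dx + (r₀/π) ∫_{∂B_{r₀}} U^μ dℋ¹ + r₀², where the boundary integral is taken with respect to arclength (one-dimensional Hausdorff) measure on the circle ∂B_{r₀} = {|x| = r₀}. -/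
open MeasureTheory Real
open scoped ENNReal

/-- The logarithmic potential `U^μ(x) = ∫ log(1/|x-y|) dμ(y)`. -/
noncomputable def logPot (μ : Measure Plane) (x : Plane) : ℝ := ∫ y, logKernel x y ∂μ

open Metric Set Filter Topology

lemma le_dist_circleMap {r δ s t : ℝ} (hr : 0 < r) (hst : |s - t| ≤ δ) (hδ : δ ≤ 1) :
    (1 - δ ^ 2) * r * |s - t| ≤ dist (circleMap 0 r s) (circleMap 0 r t) := by
  have hdist : dist (circleMap 0 r s) (circleMap 0 r t) = r * (2 * |sin ((s - t) / 2)|) := by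
    have h : circleMap 0 r s - circleMap 0 r t
        = r * Complex.exp (t * Complex.I) * (Complex.exp (Complex.I * (s - t : ℝ)) - 1) := by
      simp only [circleMap, zero_add, mul_sub, mul_assoc, ← Complex.exp_add, mul_one]
      congr 3
      push_cast
      ring
    rw [dist_eq_norm, h, norm_mul, norm_mul, Complex.norm_exp_ofReal_mul_I,
      Complex.norm_exp_I_mul_ofReal_sub_one]
    simp [abs_of_pos hr]
  have hsin : |sin ((s - t) / 2)| = sin (|s - t| / 2) := by
    rw [abs_sin_eq_sin_abs_of_abs_le_pi, abs_div, abs_two]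
    rw [abs_div, abs_two]
    linarith [pi_gt_three]
  rw [hdist, hsin]
  rcases (abs_nonneg (s - t)).eq_or_lt with h0 | h0
  · simp [← h0]
  have h1 := sin_gt_sub_cube (half_pos h0)
  have h2 : |s - t| ^ 2 ≤ δ ^ 2 := by gcongr
  have h3 : (1 - δ ^ 2) * |s - t| ≤ 2 * sin (|s - t| / 2) := by
    nlinarith [mul_le_mul_of_nonneg_right h2 h0.le, pow_pos h0 3]
  nlinarith [mul_le_mul_of_nonneg_left h3 hr.le]

lemma le_hausdorffMeasure_circleMap_image_Ioc {r δ : ℝ} (a : ℝ) (hr : 0 < r) (hδ : δ < 1)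
    (hδ0 : 0 ≤ δ) :
    ENNReal.ofReal ((1 - δ ^ 2) * r * δ) ≤ μH[1] (circleMap 0 r '' Ioc a (a + δ)) := by
  have hc : 0 < (1 - δ ^ 2) * r := mul_pos (by nlinarith) hr
  set c := (1 - δ ^ 2) * r with hcdef
  have hanti : AntilipschitzWith (Real.toNNReal c⁻¹)
      (fun x : Ioc a (a + δ) => circleMap 0 r x) := by
    refine AntilipschitzWith.of_le_mul_dist fun x y => ?_
    have hxy : |(x : ℝ) - y| ≤ δ := by
      rw [abs_le]; constructor <;> linarith [x.2.1, x.2.2, y.2.1, y.2.2]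
    rw [Real.coe_toNNReal _ (inv_nonneg.2 hc.le), inv_mul_eq_div, le_div_iff₀ hc, mul_comm,
      Subtype.dist_eq, Real.dist_eq]
    exact le_dist_circleMap hr hxy hδ.le
  have h := hanti.le_hausdorffMeasure_image zero_le_one univ
  rw [← isometry_subtype_coe.hausdorffMeasure_image (Or.inl zero_le_one), image_univ,
    Subtype.range_coe, hausdorffMeasure_real, Real.volume_Ioc, image_univ,
    ← Function.comp_def (circleMap 0 r), range_comp, Subtype.range_coe, ENNReal.rpow_one,
    add_sub_cancel_left] at h
  calc ENNReal.ofReal (c * δ) = ENNReal.ofReal c * ENNReal.ofReal δ :=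
        ENNReal.ofReal_mul hc.le
    _ ≤ ENNReal.ofReal c * (ENNReal.ofReal c⁻¹ * μH[1] (circleMap 0 r '' Ioc a (a + δ))) := by
        gcongr; exact h
    _ = _ := by
        rw [← mul_assoc, ← ENNReal.ofReal_mul hc.le, mul_inv_cancel₀ hc.ne', ENNReal.ofReal_one,
          one_mul]

lemma injOn_circleMap_Ioc {r : ℝ} (hr : 0 < r) : InjOn (circleMap 0 r) (Ioc 0 (2 * π)) := by
  have h : InjOn (circleMap 0 r) (uIoc 0 (2 * π)) :=
    injOn_circleMap_of_abs_sub_le hr.ne' (by simp [abs_of_pos pi_pos])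
  rwa [uIoc_of_le two_pi_pos.le] at h

lemma measurableSet_circleMap_image {r : ℝ} (hr : 0 < r) {s : Set ℝ} (hs : MeasurableSet s)
    (hs' : s ⊆ Ioc 0 (2 * π)) : MeasurableSet (circleMap 0 r '' s) :=
  hs.image_of_continuousOn_injOn (continuous_circleMap 0 r).continuousOn
    ((injOn_circleMap_Ioc hr).mono hs')

lemma le_hausdorffMeasure_sphere {r : ℝ} (hr : 0 < r) :
    ENNReal.ofReal (2 * π * r) ≤ μH[1] (sphere (0 : ℂ) r) := by
  have key : ∀ n : ℕ, 7 ≤ n →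
      ENNReal.ofReal ((1 - (2 * π / n) ^ 2) * r * (2 * π)) ≤ μH[1] (sphere (0 : ℂ) r) := by
    intro n hn
    have hn' : (7 : ℝ) ≤ n := by exact_mod_cast hn
    have hn0 : (0 : ℝ) < n := by linarith
    set δ := 2 * π / n with hδ
    have hδ0 : 0 ≤ δ := by positivity
    have hδ1 : δ < 1 := by
      rw [hδ, div_lt_one hn0]; linarith [pi_lt_d2]
    have hnδ : n * δ = 2 * π := by rw [hδ]; field_simp
    have hc : 0 ≤ (1 - δ ^ 2) * r * δ := by
      have : 0 ≤ 1 - δ ^ 2 := by nlinarith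
      positivity
    have ind : ∀ k : ℕ, k ≤ n → ENNReal.ofReal (k * ((1 - δ ^ 2) * r * δ)) ≤
        μH[1] (circleMap 0 r '' Ioc 0 (k * δ)) := by
      intro k
      induction k with
      | zero => simp
      | succ k ih =>
        intro hk
        have hkδ : ((k + 1 : ℕ) : ℝ) * δ = k * δ + δ := by push_cast; ring
        have hle : k * δ + δ ≤ 2 * π := by
          rw [← hkδ, ← hnδ]; gcongr
        have hk0 : 0 ≤ k * δ := by positivity
        rw [hkδ, ← Ioc_union_Ioc_eq_Ioc hk0 (by linarith), image_union, measure_union]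
        · have : ((k + 1 : ℕ) : ℝ) * ((1 - δ ^ 2) * r * δ)
              = k * ((1 - δ ^ 2) * r * δ) + (1 - δ ^ 2) * r * δ := by push_cast; ring
          rw [this, ENNReal.ofReal_add (by positivity) hc]
          exact add_le_add (ih (by omega)) (le_hausdorffMeasure_circleMap_image_Ioc _ hr hδ1 hδ0)
        · rw [disjoint_iff_inter_eq_empty, ← (injOn_circleMap_Ioc hr).image_inter
            (Ioc_subset_Ioc le_rfl (by linarith)) (Ioc_subset_Ioc hk0 hle), image_eq_empty,
            ← disjoint_iff_inter_eq_empty]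
          exact disjoint_left.2 fun x hx hx' => hx'.1.not_ge hx.2
        · exact measurableSet_circleMap_image hr measurableSet_Ioc (Ioc_subset_Ioc hk0 hle)
    have := ind n le_rfl
    rw [hnδ, image_circleMap_Ioc, abs_of_pos hr] at this
    convert this using 2
    rw [← hnδ]; ring
  refine le_of_tendsto
    (f := fun n : ℕ => ENNReal.ofReal ((1 - (2 * π / n) ^ 2) * r * (2 * π))) ?_
    ((eventually_ge_atTop 7).mono key)
  have h : Tendsto (fun n : ℕ => 2 * π / (n : ℝ)) atTop (𝓝 0) :=
    tendsto_const_div_atTop_nhds_zero_nat _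
  refine ENNReal.tendsto_ofReal ?_
  convert ((tendsto_const_nhds (x := (1 : ℝ))).sub (h.pow 2)).mul_const r |>.mul_const (2 * π)
    using 2
  ring

/-- Arclength on a circle is the push-forward of Lebesgue measure under the angular
parametrization. -/
lemma hausdorffMeasure_restrict_sphere {r : ℝ} (hr : 0 < r) :
    (μH[1] : Measure ℂ).restrict (sphere 0 r)
      = (ENNReal.ofReal r • volume.restrict (Ioc 0 (2 * π))).map (circleMap 0 r) := by
  have hm : Measurable (circleMap 0 r) := (continuous_circleMap 0 r).measurable
  have hle : (μH[1] : Measure ℂ).restrict (sphere 0 r)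
      ≤ (ENNReal.ofReal r • volume.restrict (Ioc 0 (2 * π))).map (circleMap 0 r) := by
    refine Measure.le_iff.2 fun s hs => ?_
    rw [Measure.restrict_apply hs, Measure.map_apply hm hs, Measure.smul_apply,
      Measure.restrict_apply (hm hs), ← abs_of_pos hr, ← image_circleMap_Ioc, inter_comm,
      ← image_inter_preimage, inter_comm, abs_of_pos hr]
    have h := (lipschitzWith_circleMap 0 r).hausdorffMeasure_image_le zero_le_one
      (circleMap 0 r ⁻¹' s ∩ Ioc 0 (2 * π))
    rw [hausdorffMeasure_real, ENNReal.rpow_one, Real.nnabs_of_nonneg hr.le] at h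
    exact h
  have : IsFiniteMeasure
      ((ENNReal.ofReal r • volume.restrict (Ioc 0 (2 * π))).map (circleMap 0 r)) := by
    have : IsFiniteMeasure (ENNReal.ofReal r • (volume : Measure ℝ).restrict (Ioc 0 (2 * π))) :=
      Measure.smul_finite _ ENNReal.ofReal_ne_top
    infer_instance
  have hfin := isFiniteMeasure_of_le _ hle
  refine Measure.eq_of_le_of_measure_univ_eq hle (le_antisymm (hle _) ?_)
  rw [Measure.map_apply hm MeasurableSet.univ]
  simp only [preimage_univ, Measure.smul_apply, Measure.restrict_apply_univ, volume_Ioc, sub_zero,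
    smul_eq_mul]
  rw [← ENNReal.ofReal_mul hr.le, mul_comm]
  exact le_hausdorffMeasure_sphere hr

lemma integrableOn_log_norm_ball (R : ℝ) : IntegrableOn (fun z : ℂ => log ‖z‖) (ball 0 R) := by
  rw [← integrable_indicator_iff measurableSet_ball]
  have h : (ball (0 : ℂ) R).indicator (fun z => log ‖z‖)
      = fun z => (Iio R).indicator log ‖z‖ := by
    ext z; simp only [indicator, mem_ball_zero_iff, mem_Iio]
  rw [h, integrable_fun_norm_addHaar volume (f := (Iio R).indicator log)]
  have h2 : (fun y : ℝ => y ^ (Module.finrank ℝ ℂ - 1) • (Iio R).indicator log y)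
      = (Iio R).indicator fun y => y * log y := by
    ext y; simp [indicator_apply, Complex.finrank_real_complex]
  rw [h2, integrableOn_indicator_iff measurableSet_Iio, Iio_inter_Ioi]
  exact continuous_mul_log.integrableOn_Ioc.mono_set Ioo_subset_Ioc_self

lemma integrableOn_log_norm_sub_ball (r : ℝ) (y : ℂ) :
    IntegrableOn (fun z : ℂ => log ‖z - y‖) (ball 0 r) ∧
      ∫ z in ball 0 r, ‖log ‖z - y‖‖ ≤ ∫ z in ball 0 (r + ‖y‖), ‖log ‖(z : ℂ)‖‖ := by
  have hsub : ball (0 : ℂ) r ⊆ (fun z => z - y) ⁻¹' ball 0 (r + ‖y‖) := fun z hz => by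
    rw [mem_preimage, mem_ball_zero_iff]
    exact (norm_sub_le _ _).trans_lt (by gcongr; exact mem_ball_zero_iff.1 hz)
  have hmp := measurePreserving_sub_right (volume : Measure ℂ) y
  have hemb := (MeasurableEquiv.subRight y).measurableEmbedding
  have hint : IntegrableOn (fun z : ℂ => log ‖z - y‖)
      ((fun z => z - y) ⁻¹' ball 0 (r + ‖y‖)) :=
    (hmp.integrableOn_comp_preimage hemb).2 (integrableOn_log_norm_ball _)
  refine ⟨hint.mono_set hsub, ?_⟩
  rw [← hmp.setIntegral_preimage_emb hemb (fun z => ‖log ‖z‖‖)]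
  exact setIntegral_mono_set hint.norm (ae_of_all _ fun _ => norm_nonneg _) hsub.eventuallyLE

lemma integral_mul_log {a b : ℝ} (ha : 0 ≤ a) (hab : a ≤ b) :
    ∫ s in a..b, s * log s
      = (b ^ 2 / 2 * log b - b ^ 2 / 4) - (a ^ 2 / 2 * log a - a ^ 2 / 4) := by
  refine intervalIntegral.integral_eq_sub_of_hasDerivAt_of_le
    (f := fun s => s ^ 2 / 2 * log s - s ^ 2 / 4) hab ?_ (fun s hs => ?_)
    (continuous_mul_log.intervalIntegrable _ _)
  · have : (fun s : ℝ => s ^ 2 / 2 * log s - s ^ 2 / 4)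
        = fun s => s / 2 * (s * log s) - s ^ 2 / 4 := by ext s; ring
    rw [this]
    exact (((continuous_id.div_const 2).mul continuous_mul_log).sub (by fun_prop)).continuousOn
  · have hs0 : s ≠ 0 := (ha.trans_lt hs.1).ne'
    refine ((((hasDerivAt_pow 2 s).div_const 2).fun_mul (hasDerivAt_log hs0)).fun_sub
      ((hasDerivAt_pow 2 s).div_const 4)).congr_deriv ?_
    simp
    field_simp
    ring

lemma integral_mul_circleAverage_log {r : ℝ} {y : ℂ} (hy : ‖y‖ ≤ r) :
    ∫ s in (0)..r, s * circleAverage (fun z => log ‖z - y‖) 0 s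
      = r ^ 2 / 2 * log r - (r ^ 2 - ‖y‖ ^ 2) / 4 := by
  have h1 : EqOn (fun s => s * circleAverage (fun z => log ‖z - y‖) 0 s)
      (fun s => s * log ‖y‖) (Ioo 0 ‖y‖) := fun s hs => by
    have hs' : 1 ≤ |s⁻¹ * ‖y‖| := by
      rw [abs_of_nonneg (mul_nonneg (inv_nonneg.2 hs.1.le) (norm_nonneg _)), inv_mul_eq_div,
        one_le_div hs.1]
      exact hs.2.le
    simp only
    rw [circleAverage_log_norm_sub_const_eq_log_radius_add_posLog hs.1.ne', zero_sub, norm_neg,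
      posLog_eq_log hs', log_mul (inv_ne_zero hs.1.ne') (hs.1.trans hs.2).ne', log_inv]
    ring
  have h2 : EqOn (fun s => s * circleAverage (fun z => log ‖z - y‖) 0 s)
      (fun s => s * log s) (Ioo ‖y‖ r) := fun s hs => by
    have hs0 : 0 < s := (norm_nonneg y).trans_lt hs.1
    simp only
    rw [circleAverage_log_norm_sub_const_of_mem_closedBall]
    simpa [abs_of_pos hs0] using hs.1.le
  have i1 : IntervalIntegrable (fun s => s * circleAverage (fun z => log ‖z - y‖) 0 s) volume
      0 ‖y‖ := by
    rw [intervalIntegrable_iff_integrableOn_Ioo_of_le (norm_nonneg y)]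
    refine IntegrableOn.congr_fun ?_ h1.symm measurableSet_Ioo
    rw [← intervalIntegrable_iff_integrableOn_Ioo_of_le (norm_nonneg y)]
    exact (by fun_prop : Continuous fun s : ℝ => s * log ‖y‖).intervalIntegrable _ _
  have i2 : IntervalIntegrable (fun s => s * circleAverage (fun z => log ‖z - y‖) 0 s) volume
      ‖y‖ r := by
    rw [intervalIntegrable_iff_integrableOn_Ioo_of_le hy]
    refine IntegrableOn.congr_fun ?_ h2.symm measurableSet_Ioo
    rw [← intervalIntegrable_iff_integrableOn_Ioo_of_le hy]
    exact continuous_mul_log.intervalIntegrable _ _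
  rw [← intervalIntegral.integral_add_adjacent_intervals i1 i2,
    intervalIntegral.integral_of_le (norm_nonneg y), integral_Ioc_eq_integral_Ioo,
    setIntegral_congr_fun measurableSet_Ioo h1, ← integral_Ioc_eq_integral_Ioo,
    ← intervalIntegral.integral_of_le (norm_nonneg y),
    intervalIntegral.integral_of_le hy, integral_Ioc_eq_integral_Ioo,
    setIntegral_congr_fun measurableSet_Ioo h2, ← integral_Ioc_eq_integral_Ioo,
    ← intervalIntegral.integral_of_le hy, integral_mul_log (norm_nonneg y) hy,
    intervalIntegral.integral_mul_const, integral_id]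
  ring

lemma integral_polarCoord_angle (f : ℂ → ℝ) (s : ℝ) :
    ∫ θ in Ioo (-π) π, f (Complex.polarCoord.symm (s, θ)) = 2 * π * circleAverage f 0 s := by
  have h : ∀ θ, Complex.polarCoord.symm (s, θ) = circleMap 0 s θ := fun θ => by
    rw [Complex.polarCoord_symm_apply, circleMap, Complex.exp_mul_I]
    push_cast
    ring
  simp only [h]
  rw [circleAverage_eq_integral_add (-π),
    intervalIntegral.integral_comp_add_right (fun θ => f (circleMap 0 s θ)),
    ← integral_Ioc_eq_integral_Ioo, ← intervalIntegral.integral_of_le (by linarith [pi_pos]),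
    smul_eq_mul, mul_inv_cancel_left₀ two_pi_pos.ne']
  congr 1 <;> ring

lemma integral_eq_integral_circleAverage {f : ℂ → ℝ} (hf : Integrable f) (hfm : Measurable f) :
    ∫ z, f z = ∫ s in Ioi 0, s * (2 * π * circleAverage f 0 s) := by
  have hsymm : Measurable fun p : ℝ × ℝ => Complex.polarCoord.symm p := by
    simp only [Complex.polarCoord_symm_apply]
    fun_prop
  have hint : IntegrableOn (fun p : ℝ × ℝ => p.1 • f (Complex.polarCoord.symm p))
      (Ioi 0 ×ˢ Ioo (-π) π) := by
    refine ⟨(measurable_fst.smul (hfm.comp hsymm)).aestronglyMeasurable, ?_⟩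
    have h := hf.2
    rw [HasFiniteIntegral, ← Complex.lintegral_comp_polarCoord_symm, polarCoord_target] at h
    rw [HasFiniteIntegral]
    convert h using 1
    refine setLIntegral_congr_fun (measurableSet_Ioi.prod measurableSet_Ioo) fun p hp => ?_
    rw [enorm_smul, Real.enorm_of_nonneg (le_of_lt hp.1), smul_eq_mul]
  rw [← Complex.integral_comp_polarCoord_symm, polarCoord_target, Measure.volume_eq_prod,
    setIntegral_prod _ hint]
  refine setIntegral_congr_fun measurableSet_Ioi fun s _ => ?_
  simp only [smul_eq_mul]
  rw [integral_const_mul, integral_polarCoord_angle]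

lemma integral_ball_log_norm_sub {r : ℝ} {y : ℂ} (hy : ‖y‖ ≤ r) :
    ∫ z in ball 0 r, log ‖z - y‖ = π * (r ^ 2 * log r - (r ^ 2 - ‖y‖ ^ 2) / 2) := by
  have hr : 0 ≤ r := (norm_nonneg y).trans hy
  have havg : ∀ s ∈ Ioi (0 : ℝ),
      s * (2 * π * circleAverage ((ball 0 r).indicator fun z => log ‖z - y‖) 0 s)
        = (Iio r).indicator
            (fun s => 2 * π * (s * circleAverage (fun z => log ‖z - y‖) 0 s)) s := by
    intro s hs
    have hs0 : 0 < s := hs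
    by_cases hsr : s < r
    · rw [indicator_of_mem (mem_Iio.2 hsr), circleAverage_congr_sphere
        (f₂ := fun z => log ‖z - y‖)]
      · ring
      · intro z hz
        refine indicator_of_mem ?_ _
        simpa [(mem_sphere_zero_iff_norm.1 hz), abs_of_pos hs0] using hsr
    · rw [indicator_of_notMem (by simpa using hsr), circleAverage_congr_sphere
        (f₂ := fun _ => 0)]
      · simp [circleAverage_const]
      · intro z hz
        refine indicator_of_notMem ?_ _
        simpa [(mem_sphere_zero_iff_norm.1 hz), abs_of_pos hs0] using hsr
  rw [← integral_indicator measurableSet_ball, integral_eq_integral_circleAverage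
    ((integrable_indicator_iff measurableSet_ball).2 (integrableOn_log_norm_sub_ball r y).1)
    ((by fun_prop : Measurable fun z : ℂ => log ‖z - y‖).indicator measurableSet_ball),
    setIntegral_congr_fun measurableSet_Ioi havg, setIntegral_indicator measurableSet_Iio,
    Ioi_inter_Iio, ← integral_Ioc_eq_integral_Ioo, ← intervalIntegral.integral_of_le hr,
    intervalIntegral.integral_const_mul, integral_mul_circleAverage_log hy]
  ring

lemma integral_sphere_hausdorffMeasure {r : ℝ} (hr : 0 < r) {f : ℂ → ℝ} (hf : Measurable f) :
    ∫ z in sphere 0 r, f z ∂μH[1] = 2 * π * r * circleAverage f 0 r := by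
  rw [hausdorffMeasure_restrict_sphere hr,
    integral_map (continuous_circleMap 0 r).aemeasurable hf.aestronglyMeasurable,
    integral_smul_measure, ENNReal.toReal_ofReal hr.le, circleAverage_def,
    intervalIntegral.integral_of_le two_pi_pos.le]
  simp only [smul_eq_mul]
  field_simp

/-- The standard isometry from `ℂ` to the Euclidean plane. -/
noncomputable def complexIsometryPlane : ℂ ≃ₗᵢ[ℝ] Plane := Complex.orthonormalBasisOneI.repr

lemma logKernel_complexIsometryPlane (z : ℂ) (y : Plane) :
    logKernel (complexIsometryPlane z) y = -log ‖z - complexIsometryPlane.symm y‖ := by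
  rw [logKernel, one_div, log_inv, ← complexIsometryPlane.symm.dist_map,
    LinearIsometryEquiv.symm_apply_apply, dist_eq_norm]

lemma measurable_logKernel : Measurable fun p : Plane × Plane => logKernel p.1 p.2 := by
  unfold logKernel
  fun_prop

lemma measurePreserving_complexIsometryPlane_ball (r : ℝ) :
    MeasurePreserving complexIsometryPlane (volume.restrict (ball 0 r))
      (volume.restrict (ball 0 r)) := by
  have h := complexIsometryPlane.measurePreserving.restrict_preimage
    (measurableSet_ball (x := 0) (ε := r))
  simpa using h

lemma measurePreserving_complexIsometryPlane_sphere (r : ℝ) :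
    MeasurePreserving complexIsometryPlane ((μH[1] : Measure ℂ).restrict (sphere 0 r))
      ((μH[1] : Measure Plane).restrict (sphere 0 r)) := by
  have h := (complexIsometryPlane.toIsometryEquiv.measurePreserving_hausdorffMeasure
    1).restrict_preimage (isClosed_sphere (x := 0) (ε := r)).measurableSet
  simpa using h

lemma measurableEmbedding_complexIsometryPlane : MeasurableEmbedding complexIsometryPlane :=
  complexIsometryPlane.toHomeomorph.measurableEmbedding

lemma integrableOn_logKernel_ball {r : ℝ} {y : Plane} (hy : ‖y‖ ≤ r) :
    Integrable (fun x => logKernel x y) (volume.restrict (ball 0 r)) ∧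
      ∫ x in ball 0 r, ‖logKernel x y‖ ≤ ∫ z in ball 0 (r + r), ‖log ‖(z : ℂ)‖‖ := by
  have hmp := measurePreserving_complexIsometryPlane_ball r
  have hemb := measurableEmbedding_complexIsometryPlane
  obtain ⟨h1, h2⟩ := integrableOn_log_norm_sub_ball r (complexIsometryPlane.symm y)
  constructor
  · rw [← hmp.integrable_comp_emb hemb]
    simp only [Function.comp_def, logKernel_complexIsometryPlane]
    exact Integrable.neg h1
  · rw [← hmp.integral_comp hemb]
    simp only [logKernel_complexIsometryPlane, norm_neg]
    refine h2.trans (setIntegral_mono_set (integrableOn_log_norm_ball _).norm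
      (ae_of_all _ fun _ => norm_nonneg _) (ball_subset_ball ?_).eventuallyLE)
    simpa using hy

lemma integral_ball_logKernel {r : ℝ} {y : Plane} (hy : ‖y‖ ≤ r) :
    ∫ x in ball 0 r, logKernel x y = π / 2 * (r ^ 2 - ‖y‖ ^ 2) - π * r ^ 2 * log r := by
  rw [← (measurePreserving_complexIsometryPlane_ball r).integral_comp
    measurableEmbedding_complexIsometryPlane]
  simp only [logKernel_complexIsometryPlane]
  rw [integral_neg, integral_ball_log_norm_sub (by simpa using hy),
    LinearIsometryEquiv.norm_map]
  ring

lemma integral_sphere_logKernel {r : ℝ} (hr : 0 < r) {y : Plane} (hy : ‖y‖ ≤ r) :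
    ∫ x in sphere 0 r, logKernel x y ∂μH[1] = -(2 * π * r * log r) := by
  rw [← (measurePreserving_complexIsometryPlane_sphere r).integral_comp
    measurableEmbedding_complexIsometryPlane]
  simp only [logKernel_complexIsometryPlane]
  rw [integral_neg, integral_sphere_hausdorffMeasure hr (by fun_prop),
    circleAverage_log_norm_sub_const_of_mem_closedBall]
  simpa [abs_of_pos hr] using hy

lemma isFiniteMeasure_hausdorffMeasure_restrict_sphere {r : ℝ} (hr : 0 < r) :
    IsFiniteMeasure ((μH[1] : Measure Plane).restrict (sphere 0 r)) := by
  rw [← (measurePreserving_complexIsometryPlane_sphere r).map_eq,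
    hausdorffMeasure_restrict_sphere hr]
  have : IsFiniteMeasure (ENNReal.ofReal r • (volume : Measure ℝ).restrict (Ioc 0 (2 * π))) :=
    Measure.smul_finite _ ENNReal.ofReal_ne_top
  infer_instance

lemma exists_logKernel_sphere_bound {r : ℝ} {K : Set Plane} (hK : IsCompact K)
    (hKb : K ⊆ ball 0 r) :
    ∃ C, ∀ x ∈ sphere (0 : Plane) r, ∀ y ∈ K, ‖logKernel x y‖ ≤ C := by
  have hcont : ContinuousOn (fun p : Plane × Plane => logKernel p.1 p.2) (sphere 0 r ×ˢ K) := by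
    have h : ∀ p ∈ sphere (0 : Plane) r ×ˢ K, dist p.1 p.2 ≠ 0 := by
      rintro ⟨x, y⟩ ⟨hx, hy⟩ hxy
      have hxy' : x = y := dist_eq_zero.1 hxy
      have h2 := mem_ball.1 (hKb hy)
      rw [← hxy', mem_sphere.1 hx] at h2
      exact h2.false
    exact (continuousOn_const.div continuous_dist.continuousOn h).log
      fun p hp => one_div_ne_zero (h p hp)
  obtain ⟨C, hC⟩ := ((isCompact_sphere 0 r).prod hK).exists_bound_of_continuousOn hcont
  exact ⟨C, fun x hx y hy => hC (x, y) ⟨hx, hy⟩⟩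

/-- Fubini for the potential of a finite measure, given a uniform `L¹` bound on the kernel. -/
lemma integral_logPot {σ μ : Measure Plane} [SFinite σ] [IsFiniteMeasure μ] {C : ℝ}
    (h : ∀ᵐ y ∂μ, Integrable (fun x => logKernel x y) σ ∧ ∫ x, ‖logKernel x y‖ ∂σ ≤ C) :
    ∫ x, logPot μ x ∂σ = ∫ y, ∫ x, logKernel x y ∂σ ∂μ := by
  refine integral_integral_swap ?_
  have hm : AEStronglyMeasurable (Function.uncurry logKernel) (σ.prod μ) :=
    measurable_logKernel.aestronglyMeasurable
  refine (integrable_prod_iff' hm).2 ⟨h.mono fun y hy => hy.1, ?_⟩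
  refine Integrable.of_bound hm.norm.prod_swap.integral_prod_right' C (h.mono fun y hy => ?_)
  rw [Real.norm_of_nonneg (integral_nonneg fun _ => norm_nonneg _)]
  exact hy.2

/-- for a compactly supported probability measure `μ` on `ℝ²`
with finite logarithmic energy whose support is contained in the open ball
`B_{r₀}`, one has
`∫ |x|² dμ = -(2/π) ∫_{B_{r₀}} U^μ + (r₀/π) ∫_{∂B_{r₀}} U^μ dℋ¹ + r₀²`,
the boundary integral being with respect to the one-dimensional Hausdorff
measure on the circle `{|x| = r₀}`. -/
theorem statement16 (r₀ : ℝ) (μ : Measure Plane) [IsProbabilityMeasure μ]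
    (K : Set Plane) (hK : IsCompact K) (hKb : K ⊆ Metric.ball (0 : Plane) r₀)
    (hμK : μ Kᶜ = 0)
    (hE : Integrable (fun p : Plane × Plane => logKernel p.1 p.2) (μ.prod μ)) :
    ∫ x, ‖x‖ ^ 2 ∂μ
      = -(2 / π) * (∫ x in Metric.ball (0 : Plane) r₀, logPot μ x ∂volume)
        + (r₀ / π) * (∫ x in Metric.sphere (0 : Plane) r₀, logPot μ x ∂(μH[(1 : ℝ)]))
        + r₀ ^ 2 := by
  have hmem : ∀ᵐ y ∂μ, y ∈ K := by rwa [ae_iff]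
  have hnorm : ∀ᵐ y ∂μ, ‖y‖ ≤ r₀ :=
    hmem.mono fun y hy => (mem_ball_zero_iff.1 (hKb hy)).le
  have hr : 0 < r₀ := by
    obtain ⟨y, hy⟩ := hmem.exists
    exact (norm_nonneg y).trans_lt (mem_ball_zero_iff.1 (hKb hy))
  have hsq : Integrable (fun y : Plane => ‖y‖ ^ 2) μ :=
    Integrable.of_bound (by fun_prop) (r₀ ^ 2) (hnorm.mono fun y hy => by
      rw [Real.norm_of_nonneg (sq_nonneg _)]; gcongr)
  have hsub : Integrable (fun y : Plane => r₀ ^ 2 - ‖y‖ ^ 2) μ := (integrable_const _).sub hsq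
  have hball : ∫ x in ball (0 : Plane) r₀, logPot μ x
      = π / 2 * (r₀ ^ 2 - ∫ y, ‖y‖ ^ 2 ∂μ) - π * r₀ ^ 2 * log r₀ := by
    rw [integral_logPot (hnorm.mono fun y hy => integrableOn_logKernel_ball hy),
      integral_congr_ae (hnorm.mono fun y hy => integral_ball_logKernel hy),
      integral_sub (hsub.const_mul _) (integrable_const _),
      integral_const_mul, integral_sub (integrable_const _) hsq]
    simp
  have hsphere : ∫ x in sphere (0 : Plane) r₀, logPot μ x ∂μH[1] = -(2 * π * r₀ * log r₀) := by
    have := isFiniteMeasure_hausdorffMeasure_restrict_sphere hr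
    obtain ⟨C, hC⟩ := exists_logKernel_sphere_bound hK hKb
    have hbound : ∀ y ∈ K, ∀ᵐ x ∂(μH[1] : Measure Plane).restrict (sphere 0 r₀),
        ‖logKernel x y‖ ≤ C := fun y hy =>
      (ae_restrict_mem isClosed_sphere.measurableSet).mono fun x hx => hC x hx y hy
    have hint : ∀ y ∈ K, Integrable (fun x => logKernel x y)
        ((μH[1] : Measure Plane).restrict (sphere 0 r₀)) := fun y hy =>
      Integrable.of_bound (measurable_logKernel.comp
        (measurable_id.prodMk measurable_const)).aestronglyMeasurable C (hbound y hy)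
    rw [integral_logPot (C := ∫ _ in sphere (0 : Plane) r₀, C ∂μH[1]) (hmem.mono fun y hy =>
        ⟨hint y hy, integral_mono_ae (hint y hy).norm (integrable_const _) (hbound y hy)⟩),
      integral_congr_ae (hnorm.mono fun y hy => integral_sphere_logKernel hr hy)]
    simp
  rw [hball, hsphere]
  field_simp
  ring
end
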